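/- arXiv:2109.15011 — 6 statements merged into one kernel-verified Lean document; each statement's English description precedes it below -/
import Mathlib

section
/- Let 1 < p ≤ q < ∞ and let v, w be weights on (0,∞). Then there exists a positive constant C such that the two-weight Hardy inequality holds with constant C for every nonnegative measurable function f on (0,∞) if and only if sup_{t∈(0,∞)} W(t)^{1/q} · V(t) < ∞, i.e. sup_{t>0} (∫_t^∞ w)^{1/q} (∫_0^t v^{1−p'})^{1/p'} < ∞. -/
open MeasureTheory Set ENNReal

namespace HardyInequality

/-- A measure of a totally ordered union of open sets is the supremum of the measures. -/
lemma measure_biUnion_le_of_chain {ι α : Type*} [TopologicalSpace α] [SecondCountableTopology α]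
    [MeasurableSpace α] (μ : Measure α) (E : Set ι) (U : ι → Set α)
    (hU : ∀ i ∈ E, IsOpen (U i)) (hch : ∀ i j, U i ⊆ U j ∨ U j ⊆ U i) {M : ℝ≥0∞}
    (hM : ∀ i ∈ E, μ (U i) ≤ M) : μ (⋃ i ∈ E, U i) ≤ M := by
  obtain ⟨T, hTE, hTc, hT⟩ := TopologicalSpace.isOpen_biUnion_countable E U hU
  rw [← hT, measure_biUnion_eq_iSup hTc]
  · exact iSup₂_le fun i hi => hM i (hTE hi)
  · intro i hi j hj
    rcases hch i j with h | h
    · exact ⟨j, hj, h, subset_rfl⟩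
    · exact ⟨i, hi, subset_rfl, h⟩

lemma measure_le_of_forall_measure_Ioi_le (μ : Measure ℝ) [NullSingletonClass μ] (E : Set ℝ)
    {M : ℝ≥0∞} (hM : ∀ t ∈ E, μ (Ioi t) ≤ M) : μ E ≤ M := by
  have h0 : μ (E \ ⋃ t ∈ E, Ioi t) = 0 := by
    apply Set.Subsingleton.measure_zero
    rintro a ⟨ha, ha'⟩ b ⟨hb, hb'⟩
    simp only [mem_iUnion, mem_Ioi, not_exists, not_lt] at ha' hb'
    exact le_antisymm (ha' b hb) (hb' a ha)
  calc μ E ≤ μ ((⋃ t ∈ E, Ioi t) ∪ (E \ ⋃ t ∈ E, Ioi t)) := measure_mono (by simp)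
    _ ≤ μ (⋃ t ∈ E, Ioi t) + μ (E \ ⋃ t ∈ E, Ioi t) := measure_union_le _ _
    _ ≤ M := by
      rw [h0, add_zero]
      refine measure_biUnion_le_of_chain μ E Ioi (fun _ _ => isOpen_Ioi) (fun i j => ?_) hM
      exact (le_total j i).imp (fun h => Ioi_subset_Ioi h) (fun h => Ioi_subset_Ioi h)

lemma measure_le_of_forall_measure_Iio_le (μ : Measure ℝ) [NullSingletonClass μ] (E : Set ℝ)
    {M : ℝ≥0∞} (hM : ∀ t ∈ E, μ (Iio t) ≤ M) : μ E ≤ M := by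
  have h0 : μ (E \ ⋃ t ∈ E, Iio t) = 0 := by
    apply Set.Subsingleton.measure_zero
    rintro a ⟨ha, ha'⟩ b ⟨hb, hb'⟩
    simp only [mem_iUnion, mem_Iio, not_exists, not_lt] at ha' hb'
    exact le_antisymm (hb' a ha) (ha' b hb)
  calc μ E ≤ μ ((⋃ t ∈ E, Iio t) ∪ (E \ ⋃ t ∈ E, Iio t)) := measure_mono (by simp)
    _ ≤ μ (⋃ t ∈ E, Iio t) + μ (E \ ⋃ t ∈ E, Iio t) := measure_union_le _ _
    _ ≤ M := by
      rw [h0, add_zero]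
      refine measure_biUnion_le_of_chain μ E Iio (fun _ _ => isOpen_Iio) (fun i j => ?_) hM
      exact (le_total i j).imp (fun h => Iio_subset_Iio h) (fun h => Iio_subset_Iio h)

lemma nullSingletonClass_withDensity {α : Type*} [MeasurableSpace α] (μ : Measure α)
    [NullSingletonClass μ] (f : α → ℝ≥0∞) : NullSingletonClass (μ.withDensity f) :=
  ⟨fun x => withDensity_absolutelyContinuous μ f (measure_singleton x)⟩

lemma tsum_rpow_le_rpow_tsum {ι : Type*} (a : ι → ℝ≥0∞) {r : ℝ} (hr : 1 ≤ r) :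
    ∑' i, a i ^ r ≤ (∑' i, a i) ^ r := by
  have key : ∀ x : ℝ≥0∞, x ^ r = x * x ^ (r - 1) := fun x => by
    conv_lhs => rw [show r = 1 + (r - 1) by ring,
      ENNReal.rpow_add_of_nonneg _ _ zero_le_one (by linarith), ENNReal.rpow_one]
  calc ∑' i, a i ^ r ≤ ∑' i, a i * (∑' i, a i) ^ (r - 1) := by
        refine ENNReal.tsum_le_tsum fun i => ?_
        rw [key]
        have : 0 ≤ r - 1 := by linarith
        gcongr
        exact ENNReal.le_tsum i
    _ = (∑' i, a i) ^ r := by rw [ENNReal.tsum_mul_right, ← key]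

/-- If `x` is at most the dual weight `v ^ (1 - p')`, then `x ^ p * v ≤ x`. -/
lemma rpow_mul_le_self_of_le {p p' : ℝ} (h : p.HolderConjugate p') (v x : ℝ≥0∞)
    (hx : x ≤ v ^ (1 - p')) : x ^ p * v ≤ x := by
  have hp := h.lt
  have e : (1 - p') * (p - 1) = -1 := by
    have := h.mul_eq_add
    linarith
  calc x ^ p * v = x * x ^ (p - 1) * v := by
        conv_lhs => rw [show p = 1 + (p - 1) by ring,
          ENNReal.rpow_add_of_nonneg _ _ zero_le_one (by linarith), ENNReal.rpow_one]
    _ ≤ x * (v ^ (1 - p')) ^ (p - 1) * v := by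
        gcongr
    _ = x * (v⁻¹ * v) := by rw [← ENNReal.rpow_mul, e, ENNReal.rpow_neg_one, mul_assoc]
    _ ≤ x := mul_le_of_le_one_right' (ENNReal.inv_mul_le_one v)

/-- Hölder's inequality against the weight `v`. -/
lemma setLIntegral_mul_le {p p' : ℝ} (h : p.HolderConjugate p') {v f : ℝ → ℝ≥0∞}
    (hv : Measurable v) (hf : Measurable f) {A y : ℝ≥0∞} (hA0 : A ≠ 0) (hA : A ≠ ⊤) {D I : Set ℝ}
    (hDI : D ⊆ I) (hy : y * (∫⁻ s in I, v s ^ (1 - p')) ^ (1 / p') ≤ A) :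
    (∫⁻ s in D, f s) * y ≤ A * (∫⁻ s in D, f s ^ p * v s) ^ (1 / p) := by
  have hp := h.pos
  have hp1 := h.lt
  have hp' := h.symm.pos
  have hp'1 := h.symm.lt
  rcases eq_or_ne y 0 with rfl | hy0
  · simp
  have hS : ∫⁻ s in D, v s ^ (1 - p') ≠ ⊤ := by
    intro htop
    have : ∫⁻ s in I, v s ^ (1 - p') = ⊤ := top_unique (htop ▸ lintegral_mono_set hDI)
    rw [this, ENNReal.top_rpow_of_pos (by positivity), ENNReal.mul_top hy0] at hy
    exact hA (top_unique hy)
  rcases eq_or_ne (∫⁻ s in D, f s ^ p * v s) ⊤ with hR | hR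
  · rw [hR, ENNReal.top_rpow_of_pos (by positivity), ENNReal.mul_top hA0]
    exact le_top
  have hσ := ae_lt_top (hv.pow_const (1 - p')) hS
  have hfv := ae_lt_top ((hf.pow_const p).mul hv) hR
  have hle : ∫⁻ s in D, f s ≤
      ∫⁻ s in D, ((fun s => f s * v s ^ (1 / p)) * fun s => v s ^ (-(1 / p))) s := by
    refine lintegral_mono_ae ?_
    filter_upwards [hσ, hfv] with s h1 h2
    have hv0 : v s ≠ 0 := by
      intro h0
      rw [h0, ENNReal.zero_rpow_of_neg (by linarith)] at h1
      exact lt_irrefl _ h1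
    rcases eq_or_ne (v s) ⊤ with hvt | hvt
    · have : f s = 0 := by
        by_contra hf0
        simp only [Pi.mul_apply] at h2
        rw [hvt, ENNReal.mul_top] at h2
        · exact lt_irrefl _ h2
        · simp [ENNReal.rpow_eq_zero_iff, hf0, hp, hp.le]
      rw [this]
      exact zero_le
    · simp only [Pi.mul_apply]
      rw [mul_assoc, ← ENNReal.rpow_add _ _ hv0 hvt]
      simp
  have e1 : ∀ s, (f s * v s ^ (1 / p)) ^ p = f s ^ p * v s := fun s => by
    rw [ENNReal.mul_rpow_of_nonneg _ _ hp.le, ← ENNReal.rpow_mul, one_div_mul_cancel hp.ne',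
      ENNReal.rpow_one]
  have e2 : ∀ s, (v s ^ (-(1 / p))) ^ p' = v s ^ (1 - p') := fun s => by
    rw [← ENNReal.rpow_mul]
    congr 1
    have := h.mul_eq_add
    field_simp
    linarith
  have hH := ENNReal.lintegral_mul_le_Lp_mul_Lq (volume.restrict D) h
    (f := fun s => f s * v s ^ (1 / p)) (g := fun s => v s ^ (-(1 / p)))
    (hf.mul (hv.pow_const _)).aemeasurable (hv.pow_const _).aemeasurable
  simp only [e1, e2] at hH
  calc (∫⁻ s in D, f s) * y
      ≤ (∫⁻ s in D, f s ^ p * v s) ^ (1 / p) * (∫⁻ s in D, v s ^ (1 - p')) ^ (1 / p') * y := by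
        gcongr
        exact hle.trans hH
    _ ≤ (∫⁻ s in D, f s ^ p * v s) ^ (1 / p) * (∫⁻ s in I, v s ^ (1 - p')) ^ (1 / p') * y := by
        gcongr
    _ = (y * (∫⁻ s in I, v s ^ (1 - p')) ^ (1 / p')) * (∫⁻ s in D, f s ^ p * v s) ^ (1 / p) := by
        ring
    _ ≤ _ := by gcongr

/-- Necessity of the Muckenhoupt condition. -/
lemma muckenhoupt_of_hardy {p q p' : ℝ} (h : p.HolderConjugate p') (hq : 0 < q)
    {v w : ℝ → ℝ≥0∞} (hv : Measurable v) {C : ℝ≥0∞}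
    (H : ∀ f : ℝ → ℝ≥0∞, Measurable f →
        (∫⁻ t in Ioi (0 : ℝ), (∫⁻ s in Ioo 0 t, f s) ^ q * w t) ^ (1 / q) ≤
          C * (∫⁻ s in Ioi (0 : ℝ), f s ^ p * v s) ^ (1 / p)) {t : ℝ} (ht : 0 < t) :
    (∫⁻ s in Ioi t, w s) ^ (1 / q) * (∫⁻ s in Ioo 0 t, v s ^ (1 - p')) ^ (1 / p') ≤ C := by
  have hp := h.pos
  have hp' := h.symm.pos
  let g : ℕ → ℝ → ℝ≥0∞ := fun n s => min (v s ^ (1 - p')) n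
  have hg : ∀ n, Measurable (g n) := fun n => (hv.pow_const _).min measurable_const
  have main : ∀ n, (∫⁻ s in Ioi t, w s) ^ (1 / q) * (∫⁻ s in Ioo 0 t, g n s) ^ (1 / p') ≤ C := by
    intro n
    set I := ∫⁻ s in Ioo 0 t, g n s
    have hItop : I ≠ ⊤ := by
      have : I ≤ ∫⁻ _ in Ioo 0 t, (n : ℝ≥0∞) := lintegral_mono fun s => min_le_right _ _
      refine ne_top_of_le_ne_top ?_ this
      rw [setLIntegral_const]
      exact ENNReal.mul_ne_top (ENNReal.natCast_ne_top n) (by simp)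
    rcases eq_or_ne I 0 with hI0 | hI0
    · rw [hI0, ENNReal.zero_rpow_of_pos (by positivity), mul_zero]
      exact zero_le
    have hn := H ((Ioo 0 t).indicator (g n)) ((hg n).indicator measurableSet_Ioo)
    have hl : I * (∫⁻ s in Ioi t, w s) ^ (1 / q) ≤
        (∫⁻ r in Ioi (0 : ℝ), (∫⁻ s in Ioo 0 r, (Ioo 0 t).indicator (g n) s) ^ q * w r)
          ^ (1 / q) := by
      calc I * (∫⁻ s in Ioi t, w s) ^ (1 / q) = (I ^ q * ∫⁻ s in Ioi t, w s) ^ (1 / q) := by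
            rw [ENNReal.mul_rpow_of_nonneg _ _ (by positivity), ← ENNReal.rpow_mul,
              mul_one_div_cancel hq.ne', ENNReal.rpow_one]
        _ ≤ (∫⁻ r in Ioi t, I ^ q * w r) ^ (1 / q) := by
            rw [lintegral_const_mul' _ _ (ENNReal.rpow_ne_top_of_nonneg hq.le hItop)]
        _ ≤ (∫⁻ r in Ioi t, (∫⁻ s in Ioo 0 r, (Ioo 0 t).indicator (g n) s) ^ q * w r)
              ^ (1 / q) := by
            refine ENNReal.rpow_le_rpow (setLIntegral_mono' measurableSet_Ioi fun r hr => ?_)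
              (by positivity)
            gcongr
            rw [setLIntegral_indicator measurableSet_Ioo,
              inter_eq_left.2 (Ioo_subset_Ioo_right (le_of_lt hr))]
        _ ≤ _ := by
            gcongr
    have hr : ∫⁻ s in Ioi (0 : ℝ), (Ioo 0 t).indicator (g n) s ^ p * v s ≤ I := by
      calc ∫⁻ s in Ioi (0 : ℝ), (Ioo 0 t).indicator (g n) s ^ p * v s
          ≤ ∫⁻ s in Ioi (0 : ℝ), (Ioo 0 t).indicator (g n) s := by
            refine lintegral_mono fun s => rpow_mul_le_self_of_le h _ _ ?_
            exact (indicator_le_self _ _ s).trans (min_le_left _ _)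
        _ = I := by
            rw [setLIntegral_indicator measurableSet_Ioo, inter_eq_left.2 Ioo_subset_Ioi_self]
    have hx0 : I ^ (1 / p) ≠ 0 := by simp [ENNReal.rpow_eq_zero_iff, hI0, hItop]
    have hxt : I ^ (1 / p) ≠ ⊤ := ENNReal.rpow_ne_top_of_nonneg (by positivity) hItop
    have hsplit : I = I ^ (1 / p') * I ^ (1 / p) := by
      rw [← ENNReal.rpow_add _ _ hI0 hItop, one_div, one_div, add_comm, h.inv_add_inv_eq_one,
        ENNReal.rpow_one]
    rw [← ENNReal.mul_le_mul_iff_left hx0 hxt]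
    calc (∫⁻ s in Ioi t, w s) ^ (1 / q) * I ^ (1 / p') * I ^ (1 / p)
        = I * (∫⁻ s in Ioi t, w s) ^ (1 / q) := by
          rw [mul_assoc, ← hsplit, mul_comm]
      _ ≤ _ := hl.trans hn
      _ ≤ C * I ^ (1 / p) := by gcongr
  have hsup : ∫⁻ s in Ioo 0 t, v s ^ (1 - p') = ⨆ n, ∫⁻ s in Ioo 0 t, g n s := by
    rw [← lintegral_iSup hg]
    · refine lintegral_congr fun s => ?_
      simp only [g]
      rw [← inf_iSup_eq, ENNReal.iSup_natCast, inf_top_eq]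
    · intro m n hmn s
      exact min_le_min le_rfl (by exact_mod_cast hmn)
  have hpow : (⨆ n, ∫⁻ s in Ioo 0 t, g n s) ^ (1 / p') =
      ⨆ n, (∫⁻ s in Ioo 0 t, g n s) ^ (1 / p') :=
    (ENNReal.orderIsoRpow (1 / p') (by positivity)).map_iSup _
  rw [hsup, hpow, ENNReal.mul_iSup]
  exact iSup_le main

/-- Sufficiency of the Muckenhoupt condition, by decomposing `(0, ∞)` into the dyadic level sets
of the primitive of `f`. -/
lemma hardy_of_muckenhoupt {p q p' : ℝ} (h : p.HolderConjugate p') (hpq : p ≤ q)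
    {v w : ℝ → ℝ≥0∞} (hv : Measurable v) (hw : Measurable w) {A : ℝ≥0∞} (hA0 : A ≠ 0) (hA : A ≠ ⊤)
    (H : ∀ t : ℝ, 0 < t →
      (∫⁻ s in Ioi t, w s) ^ (1 / q) * (∫⁻ s in Ioo 0 t, v s ^ (1 - p')) ^ (1 / p') ≤ A)
    {f : ℝ → ℝ≥0∞} (hf : Measurable f) :
    (∫⁻ t in Ioi (0 : ℝ), (∫⁻ s in Ioo 0 t, f s) ^ q * w t) ^ (1 / q) ≤
      8 * A * (∫⁻ s in Ioi (0 : ℝ), f s ^ p * v s) ^ (1 / p) := by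
  have hp := h.pos
  have hp1 := h.lt
  have hq : 0 < q := hp.trans_le hpq
  set R := ∫⁻ s in Ioi (0 : ℝ), f s ^ p * v s
  rcases eq_or_ne R ⊤ with hR | hR
  · rw [hR, ENNReal.top_rpow_of_pos (by positivity), ENNReal.mul_top (by simp [hA0])]
    exact le_top
  set F : ℝ → ℝ≥0∞ := fun t => ∫⁻ s in Ioo 0 t, f s
  have hFmono : Monotone F := fun a b hab => lintegral_mono_set (Ioo_subset_Ioo_right hab)
  have hFm : Measurable F := hFmono.measurable
  set W : ℝ → ℝ≥0∞ := fun t => ∫⁻ s in Ioi t, w s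
  have hsmall : ∀ c : ℝ≥0∞, ∫⁻ s in {s | 0 < s ∧ F s ≤ c}, f s ≤ c := by
    intro c
    have := nullSingletonClass_withDensity (volume.restrict (Ioi (0 : ℝ))) f
    have := measure_le_of_forall_measure_Iio_le ((volume.restrict (Ioi (0 : ℝ))).withDensity f)
      {s | 0 < s ∧ F s ≤ c} (M := c) (fun t ht => by
        rw [withDensity_apply _ measurableSet_Iio, Measure.restrict_restrict measurableSet_Iio,
          inter_comm, Ioi_inter_Iio]
        exact ht.2)
    have hm : MeasurableSet {s | 0 < s ∧ F s ≤ c} :=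
      measurableSet_Ioi.inter (hFm measurableSet_Iic)
    rwa [withDensity_apply _ hm, Measure.restrict_restrict hm,
      inter_eq_left.2 (fun s hs => hs.1)] at this
  have hmass : ∀ (E : Set ℝ) (M : ℝ≥0∞), MeasurableSet E → (∀ t ∈ E, W t ≤ M) →
      ∫⁻ s in E, w s ≤ M := by
    intro E M hE hM
    have := nullSingletonClass_withDensity (volume : Measure ℝ) w
    have := measure_le_of_forall_measure_Ioi_le ((volume : Measure ℝ).withDensity w) E (M := M)
      (fun t ht => by
        rw [withDensity_apply _ measurableSet_Ioi]
        exact hM t ht)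
    rwa [withDensity_apply _ hE] at this
  let G : ℤ → Set ℝ := fun k => Ioi 0 ∩ F ⁻¹' Ioc (2 ^ k) (2 ^ (k + 1))
  have hGm : ∀ k, MeasurableSet (G k) := fun k => measurableSet_Ioi.inter (hFm measurableSet_Ioc)
  let b : ℤ → ℝ≥0∞ := fun k => ∫⁻ s in G k, f s ^ p * v s
  have hbsum : ∑' k, b k ≤ R := by
    rw [← lintegral_iUnion hGm]
    · exact lintegral_mono_set (iUnion_subset fun k => inter_subset_left)
    · refine fun i j hij => Disjoint.mono inter_subset_right inter_subset_right ?_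
      refine Disjoint.preimage _ ?_
      have hmono : Monotone fun k : ℤ => (2 : ℝ≥0∞) ^ k := fun a c hac =>
        ENNReal.zpow_le_of_le (by norm_num) hac
      exact hmono.pairwise_disjoint_on_Ioc_succ hij
  have h2 : ∀ k : ℤ, (2 : ℝ≥0∞) ^ (k + 1) = 2 ^ k + 2 ^ k := fun k => by
    rw [ENNReal.zpow_add (by norm_num) (by norm_num), zpow_one, mul_two]
  have h2top : ∀ k : ℤ, (2 : ℝ≥0∞) ^ k ≠ ⊤ := fun k =>
    ENNReal.zpow_ne_top (by norm_num) (by norm_num) k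
  let a : ℤ → ℝ≥0∞ := fun k => b (k - 1) + b k
  have hasum : ∑' k, a k ≤ 2 * R := by
    rw [ENNReal.tsum_add, two_mul]
    refine add_le_add (le_trans (le_of_eq ?_) hbsum) hbsum
    exact (Equiv.subRight (1 : ℤ)).tsum_eq b
  have hW_le : ∀ k, ∀ t ∈ G k, (2 : ℝ≥0∞) ^ (k - 1) * W t ^ (1 / q) ≤ A * a k ^ (1 / p) := by
    rintro k t ⟨ht0, htk, htk'⟩
    have hk : (2 : ℝ≥0∞) ^ k = 2 ^ (k - 1) + 2 ^ (k - 1) := by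
      rw [← h2, sub_add_cancel]
    have hlow : (2 : ℝ≥0∞) ^ (k - 1) ≤ ∫⁻ s in Ioo 0 t ∩ {s | 2 ^ (k - 1) < F s}, f s := by
      have : (2 : ℝ≥0∞) ^ (k - 1) + 2 ^ (k - 1) ≤
          2 ^ (k - 1) + ∫⁻ s in Ioo 0 t ∩ {s | 2 ^ (k - 1) < F s}, f s := by
        rw [← hk]
        calc (2 : ℝ≥0∞) ^ k ≤ F t := htk.le
          _ ≤ ∫⁻ s in {s | 0 < s ∧ F s ≤ 2 ^ (k - 1)} ∪ (Ioo 0 t ∩ {s | 2 ^ (k - 1) < F s}),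
                f s := by
              refine lintegral_mono_set fun s hs => ?_
              rcases le_or_gt (F s) (2 ^ (k - 1)) with h | h
              · exact Or.inl ⟨hs.1, h⟩
              · exact Or.inr ⟨hs, h⟩
          _ ≤ _ := lintegral_union_le _ _ _
          _ ≤ _ := by
              gcongr
              exact hsmall _
      exact (ENNReal.add_le_add_iff_left (h2top _)).1 this
    calc (2 : ℝ≥0∞) ^ (k - 1) * W t ^ (1 / q)
        ≤ (∫⁻ s in Ioo 0 t ∩ {s | 2 ^ (k - 1) < F s}, f s) * W t ^ (1 / q) := by gcongr
      _ ≤ A * (∫⁻ s in Ioo 0 t ∩ {s | 2 ^ (k - 1) < F s}, f s ^ p * v s) ^ (1 / p) :=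
          setLIntegral_mul_le h hv hf hA0 hA inter_subset_left (H t ht0)
      _ ≤ A * a k ^ (1 / p) := by
          gcongr
          refine le_trans (lintegral_mono_set (t := G (k - 1) ∪ G k) ?_)
            (lintegral_union_le _ _ _)
          rintro s ⟨hs, hsF⟩
          rcases le_or_gt (F s) (2 ^ k) with h | h
          · exact Or.inl ⟨hs.1, hsF, by simpa using h⟩
          · exact Or.inr ⟨hs.1, h, (hFmono hs.2.le).trans htk'⟩
  have hG_le : ∀ k, ∫⁻ t in G k, F t ^ q * w t ≤ (4 * A) ^ q * a k ^ (q / p) := by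
    intro k
    have hc0 : ((2 : ℝ≥0∞) ^ (k - 1)) ≠ 0 := (ENNReal.zpow_pos (by norm_num) (by norm_num) _).ne'
    have hw_le : ∫⁻ t in G k, w t ≤ ((2 ^ (k - 1))⁻¹ * (A * a k ^ (1 / p))) ^ q := by
      refine hmass _ _ (hGm k) fun t ht => ?_
      have h1 : W t ^ (1 / q) ≤ (2 ^ (k - 1))⁻¹ * (A * a k ^ (1 / p)) := by
        rw [← ENNReal.div_eq_inv_mul, ENNReal.le_div_iff_mul_le (Or.inl hc0) (Or.inl (h2top _)),
          mul_comm]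
        exact hW_le k t ht
      calc W t = (W t ^ (1 / q)) ^ q := by
            rw [← ENNReal.rpow_mul, one_div_mul_cancel hq.ne', ENNReal.rpow_one]
        _ ≤ _ := by gcongr
    calc ∫⁻ t in G k, F t ^ q * w t ≤ ∫⁻ t in G k, ((2 : ℝ≥0∞) ^ (k + 1)) ^ q * w t := by
          refine setLIntegral_mono' (hGm k) fun t ht => ?_
          gcongr
          exact ht.2.2
      _ = ((2 : ℝ≥0∞) ^ (k + 1)) ^ q * ∫⁻ t in G k, w t :=
          lintegral_const_mul' _ _ (ENNReal.rpow_ne_top_of_nonneg hq.le (h2top _))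
      _ ≤ ((2 : ℝ≥0∞) ^ (k + 1)) ^ q * ((2 ^ (k - 1))⁻¹ * (A * a k ^ (1 / p))) ^ q := by
          gcongr
      _ = (4 * A) ^ q * a k ^ (q / p) := by
          have e4 : (2 : ℝ≥0∞) ^ (k + 1) = 4 * 2 ^ (k - 1) := by
            rw [h2 k, ← two_mul, show k = (k - 1) + 1 by ring, h2 (k - 1), ← two_mul, ← mul_assoc]
            norm_num
          rw [← ENNReal.mul_rpow_of_nonneg _ _ hq.le, e4, mul_assoc, ← mul_assoc (2 ^ (k - 1)),
            ENNReal.mul_inv_cancel hc0 (h2top _), one_mul, ← mul_assoc,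
            ENNReal.mul_rpow_of_nonneg _ _ hq.le, ← ENNReal.rpow_mul, one_div_mul_eq_div]
  have htop : ∫⁻ t in Ioi 0 ∩ F ⁻¹' {⊤}, F t ^ q * w t = 0 := by
    have hm : MeasurableSet (Ioi 0 ∩ F ⁻¹' {⊤}) :=
      measurableSet_Ioi.inter (hFm (measurableSet_singleton _))
    have hw0 : ∫⁻ t in Ioi 0 ∩ F ⁻¹' {⊤}, w t ≤ 0 := by
      refine hmass _ _ hm fun t ht => ?_
      have h1 : F t * W t ^ (1 / q) ≤ A * R ^ (1 / p) :=
        (setLIntegral_mul_le h hv hf hA0 hA subset_rfl (H t ht.1)).trans (by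
          exact mul_le_mul_right (ENNReal.rpow_le_rpow (lintegral_mono_set Ioo_subset_Ioi_self)
            (by positivity)) _)
      have h2 : A * R ^ (1 / p) ≠ ⊤ :=
        ENNReal.mul_ne_top hA (ENNReal.rpow_ne_top_of_nonneg (by positivity) hR)
      by_contra hne
      have hW0 : W t ^ (1 / q) ≠ 0 := by
        simp only [ne_eq, ENNReal.rpow_eq_zero_iff, not_or, not_and, not_lt]
        exact ⟨fun hWt => (hne (le_of_eq hWt)).elim, fun _ => by positivity⟩
      rw [show F t = ⊤ from ht.2, ENNReal.top_mul hW0] at h1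
      exact h2 (top_unique h1)
    refine le_antisymm ?_ zero_le
    calc ∫⁻ t in Ioi 0 ∩ F ⁻¹' {⊤}, F t ^ q * w t
        ≤ ∫⁻ t in Ioi 0 ∩ F ⁻¹' {⊤}, ⊤ * w t :=
          lintegral_mono fun t => mul_le_mul_left le_top _
      _ = ⊤ * ∫⁻ t in Ioi 0 ∩ F ⁻¹' {⊤}, w t := lintegral_const_mul _ hw
      _ ≤ 0 := by rw [nonpos_iff_eq_zero.1 hw0, mul_zero]
  have hzero : ∫⁻ t in Ioi 0 ∩ F ⁻¹' {0}, F t ^ q * w t = 0 := by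
    have hm : MeasurableSet (Ioi 0 ∩ F ⁻¹' {0}) :=
      measurableSet_Ioi.inter (hFm (measurableSet_singleton _))
    rw [setLIntegral_congr_fun hm (g := fun _ => 0)]
    · simp
    · intro t ht
      simp only
      rw [show F t = 0 from ht.2, ENNReal.zero_rpow_of_pos hq, zero_mul]
  have hcover : Ioi (0 : ℝ) ⊆ (Ioi 0 ∩ F ⁻¹' {0} ∪ Ioi 0 ∩ F ⁻¹' {⊤}) ∪ ⋃ k, G k := by
    intro t ht
    rcases eq_or_ne (F t) 0 with h0 | h0
    · exact Or.inl (Or.inl ⟨ht, h0⟩)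
    rcases eq_or_ne (F t) ⊤ with h1 | h1
    · exact Or.inl (Or.inr ⟨ht, h1⟩)
    obtain ⟨k, hk⟩ := ENNReal.exists_mem_Ioc_zpow h0 h1 (y := 2) (by norm_num) (by norm_num)
    exact Or.inr (mem_iUnion.2 ⟨k, ht, hk⟩)
  have hmain : ∫⁻ t in Ioi (0 : ℝ), F t ^ q * w t ≤ (4 * A) ^ q * (2 * R) ^ (q / p) := by
    calc ∫⁻ t in Ioi (0 : ℝ), F t ^ q * w t
        ≤ ∫⁻ t in (Ioi 0 ∩ F ⁻¹' {0} ∪ Ioi 0 ∩ F ⁻¹' {⊤}) ∪ ⋃ k, G k, F t ^ q * w t :=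
          lintegral_mono_set hcover
      _ ≤ (∫⁻ t in Ioi 0 ∩ F ⁻¹' {0}, F t ^ q * w t) + (∫⁻ t in Ioi 0 ∩ F ⁻¹' {⊤}, F t ^ q * w t) +
            ∑' k, ∫⁻ t in G k, F t ^ q * w t :=
          (lintegral_union_le _ _ _).trans
            (add_le_add (lintegral_union_le _ _ _) (lintegral_iUnion_le _ _))
      _ ≤ ∑' k, (4 * A) ^ q * a k ^ (q / p) := by
          rw [htop, hzero, add_zero, zero_add]
          exact ENNReal.tsum_le_tsum hG_le
      _ = (4 * A) ^ q * ∑' k, a k ^ (q / p) := ENNReal.tsum_mul_left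
      _ ≤ (4 * A) ^ q * (∑' k, a k) ^ (q / p) := by
          gcongr
          exact tsum_rpow_le_rpow_tsum a ((one_le_div hp).2 hpq)
      _ ≤ _ := by gcongr
  calc (∫⁻ t in Ioi (0 : ℝ), F t ^ q * w t) ^ (1 / q)
      ≤ ((4 * A) ^ q * (2 * R) ^ (q / p)) ^ (1 / q) := by gcongr
    _ = 4 * A * (2 ^ (1 / p) * R ^ (1 / p)) := by
        rw [ENNReal.mul_rpow_of_nonneg _ _ (by positivity), ← ENNReal.rpow_mul, ← ENNReal.rpow_mul,
          mul_one_div_cancel hq.ne', ENNReal.rpow_one,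
          ← ENNReal.mul_rpow_of_nonneg _ _ (by positivity)]
        congr 2
        field_simp
    _ ≤ 4 * A * (2 * R ^ (1 / p)) := by
        gcongr
        calc (2 : ℝ≥0∞) ^ (1 / p) ≤ 2 ^ (1 : ℝ) :=
              ENNReal.rpow_le_rpow_of_exponent_le (by norm_num) ((div_le_one hp).2 hp1.le)
          _ = 2 := ENNReal.rpow_one _
    _ = 8 * A * R ^ (1 / p) := by ring

end HardyInequality

/-- The two-weight Hardy inequality, convex case `1 < p ≤ q < ∞`:
the inequality holds with some positive constant `C` for all nonnegative
measurable `f` iff `sup_{t>0} W(t)^{1/q} V(t) < ∞`, where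
`W(t) = ∫_t^∞ w` and `V(t) = (∫_0^t v^{1-p'})^{1/p'}`, `p' = p/(p-1)`. -/
theorem hardy_convex_case_p_gt_one (p q p' : ℝ) (hp : 1 < p) (hpq : p ≤ q)
    (hp' : p' = p / (p - 1))
    (v w : ℝ → ℝ≥0∞) (hv : Measurable v) (hw : Measurable w) :
    (∃ C : ℝ, 0 < C ∧ ∀ f : ℝ → ℝ≥0∞, Measurable f →
        (∫⁻ t in Ioi (0 : ℝ), (∫⁻ s in Ioo 0 t, f s) ^ q * w t) ^ (1 / q) ≤
          ENNReal.ofReal C * (∫⁻ s in Ioi (0 : ℝ), f s ^ p * v s) ^ (1 / p)) ↔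
    (⨆ t ∈ Ioi (0 : ℝ), (∫⁻ s in Ioi t, w s) ^ (1 / q) *
        (∫⁻ s in Ioo 0 t, v s ^ (1 - p')) ^ (1 / p')) < ⊤ := by
  have h : p.HolderConjugate p' := (Real.holderConjugate_iff_eq_conjExponent hp).2 hp'
  constructor
  · rintro ⟨C, -, H⟩
    refine lt_of_le_of_lt (iSup₂_le fun t ht => ?_) (ENNReal.ofReal_lt_top (r := C))
    exact HardyInequality.muckenhoupt_of_hardy h (by linarith) hv H ht
  · intro hS
    set S := ⨆ t ∈ Ioi (0 : ℝ), (∫⁻ s in Ioi t, w s) ^ (1 / q) *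
        (∫⁻ s in Ioo 0 t, v s ^ (1 - p')) ^ (1 / p')
    have hA : S + 1 ≠ ⊤ := ENNReal.add_ne_top.2 ⟨hS.ne, ENNReal.one_ne_top⟩
    have hA0 : S + 1 ≠ 0 := by simp
    have hC : 8 * (S + 1) ≠ ⊤ := ENNReal.mul_ne_top (by norm_num) hA
    refine ⟨(8 * (S + 1)).toReal, ENNReal.toReal_pos (by simp) hC, fun f hf => ?_⟩
    rw [ENNReal.ofReal_toReal hC]
    refine HardyInequality.hardy_of_muckenhoupt h hpq hv hw hA0 hA (fun t ht => ?_) hf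
    exact (le_iSup₂_of_le (f := fun t (_ : t ∈ Ioi (0 : ℝ)) => (∫⁻ s in Ioi t, w s) ^ (1 / q) *
        (∫⁻ s in Ioo 0 t, v s ^ (1 - p')) ^ (1 / p')) t ht le_rfl).trans le_self_add
end

section
/- Let p = 1 ≤ q < ∞ and let v, w be weights on (0,∞). Then there exists a positive constant C such that the two-weight Hardy inequality holds with constant C for every nonnegative measurable function f on (0,∞) if and only if sup_{t∈(0,∞)} W(t)^{1/q} · V(t) < ∞, i.e. sup_{t>0} (∫_t^∞ w)^{1/q} · ess sup_{s∈(0,t)} 1/v(s) < ∞. -/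
open MeasureTheory Set ENNReal

/-- The tail integral `t ↦ ∫⁻ s in Ioi t, w s` vanishes only where `w` does, up to a null set. -/
lemma ae_eq_zero_of_tail_lintegral_eq_zero {w : ℝ → ℝ≥0∞} (hw : Measurable w) :
    ∀ᵐ t : ℝ, ∫⁻ s in Ioi t, w s = 0 → w t = 0 := by
  refine ae_of_mem_of_ae_of_mem_inter_Ioo (μ := volume)
    (s := {t | ∫⁻ s in Ioi t, w s = 0}) (p := fun t => w t = 0) ?_
  intro a b ha _ _
  have h := (lintegral_eq_zero_iff hw).1 ha
  filter_upwards [(ae_restrict_iff' measurableSet_Ioi).1 h] with x hx hxm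
  exact hx hxm.2.1

/-- A bound for the tail integrals from all rationals above `s` passes to the tail integral from `s`. -/
lemma tail_lintegral_le_of_forall_rat {w : ℝ → ℝ≥0∞} {s : ℝ} {B : ℝ≥0∞}
    (h : ∀ r : ℚ, s < r → ∫⁻ x in Ioi (r : ℝ), w x ≤ B) :
    ∫⁻ x in Ioi s, w x ≤ B := by
  have hU : Ioi s = ⋃ r : {r : ℚ // s < r}, Ioi ((r : ℚ) : ℝ) := by
    ext x
    simp only [mem_Ioi, mem_iUnion, Subtype.exists, exists_prop]
    constructor
    · intro hx
      obtain ⟨r, h1, h2⟩ := exists_rat_btwn hx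
      exact ⟨r, h1, h2⟩
    · rintro ⟨r, h1, h2⟩
      exact h1.trans h2
  have hd : Directed (· ⊆ ·) (fun r : {r : ℚ // s < r} => Ioi ((r : ℚ) : ℝ)) := by
    intro a b
    rcases le_total (a : ℚ) (b : ℚ) with hab | hab
    · exact ⟨a, subset_rfl, Ioi_subset_Ioi (by exact_mod_cast hab)⟩
    · exact ⟨b, Ioi_subset_Ioi (by exact_mod_cast hab), subset_rfl⟩
  have hm : ∀ t : ℝ, ∫⁻ x in Ioi t, w x = volume.withDensity w (Ioi t) := fun t =>
    (withDensity_apply w measurableSet_Ioi).symm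
  rw [hm, hU, hd.measure_iUnion]
  refine iSup_le fun r => ?_
  rw [← hm]
  exact h r r.2

/-- Tonelli's theorem on the triangle `0 < s < t`. -/
lemma lintegral_Ioo_mul_eq_lintegral_mul_tail {g w : ℝ → ℝ≥0∞} (hg : Measurable g)
    (hw : Measurable w) :
    ∫⁻ t in Ioi (0 : ℝ), (∫⁻ s in Ioo 0 t, g s) * w t =
      ∫⁻ s in Ioi (0 : ℝ), g s * ∫⁻ t in Ioi s, w t := by
  have hT : MeasurableSet {p : ℝ × ℝ | p.2 < p.1} :=
    measurableSet_lt measurable_snd measurable_fst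
  have hK : Measurable ({p : ℝ × ℝ | p.2 < p.1}.indicator (fun p => g p.2 * w p.1)) :=
    ((hg.comp measurable_snd).mul (hw.comp measurable_fst)).indicator hT
  calc ∫⁻ t in Ioi (0 : ℝ), (∫⁻ s in Ioo 0 t, g s) * w t
      = ∫⁻ t in Ioi (0 : ℝ), ∫⁻ s in Ioi (0 : ℝ),
          {p : ℝ × ℝ | p.2 < p.1}.indicator (fun p => g p.2 * w p.1) (t, s) := by
        refine lintegral_congr fun t => ?_
        rw [← lintegral_mul_const _ hg]
        have : (fun s => {p : ℝ × ℝ | p.2 < p.1}.indicator (fun p => g p.2 * w p.1) (t, s)) =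
            (Iio t).indicator (fun s => g s * w t) := by
          ext s; simp [indicator]
        rw [this, lintegral_indicator measurableSet_Iio,
          Measure.restrict_restrict measurableSet_Iio, inter_comm, Ioi_inter_Iio]
    _ = ∫⁻ s in Ioi (0 : ℝ), ∫⁻ t in Ioi (0 : ℝ),
          {p : ℝ × ℝ | p.2 < p.1}.indicator (fun p => g p.2 * w p.1) (t, s) :=
        lintegral_lintegral_swap (f := fun t s =>
          {p : ℝ × ℝ | p.2 < p.1}.indicator (fun p => g p.2 * w p.1) (t, s)) hK.aemeasurable
    _ = ∫⁻ s in Ioi (0 : ℝ), g s * ∫⁻ t in Ioi s, w t := by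
        refine setLIntegral_congr_fun measurableSet_Ioi fun s hs => ?_
        have : (fun t => {p : ℝ × ℝ | p.2 < p.1}.indicator (fun p => g p.2 * w p.1) (t, s)) =
            (Ioi s).indicator (fun t => g s * w t) := by
          ext t; simp [indicator]
        simp only [this]
        rw [lintegral_indicator measurableSet_Ioi,
          Measure.restrict_restrict measurableSet_Ioi,
          inter_eq_left.2 (Ioi_subset_Ioi (le_of_lt hs)), lintegral_const_mul _ hw]

/-- Hölder's inequality for `f = (f v)^(1-1/q) (f v^(1-q))^(1/q)`. -/
lemma lintegral_rpow_le_mul_lintegral_mul_rpow {α : Type*} [MeasurableSpace α] {μ : Measure α}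
    {q : ℝ} (hq : 1 ≤ q) {f v : α → ℝ≥0∞} (hf : Measurable f) (hv : Measurable v)
    (h0 : ∀ᵐ s ∂μ, v s ≠ 0) (htop : ∀ᵐ s ∂μ, v s = ⊤ → f s = 0) :
    (∫⁻ s, f s ∂μ) ^ q ≤ (∫⁻ s, f s * v s ∂μ) ^ (q - 1) * ∫⁻ s, f s * v s ^ (1 - q) ∂μ := by
  have hq0 : 0 < q := by linarith
  have hinv : 0 < 1 / q := by positivity
  have hinv' : 0 ≤ 1 - 1 / q := by
    rw [sub_nonneg, div_le_one hq0]; exact hq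
  have hfac : ∫⁻ s, f s ∂μ ≤
      ∫⁻ s, (f s * v s) ^ (1 - 1 / q) * (f s * v s ^ (1 - q)) ^ (1 / q) ∂μ := by
    refine lintegral_mono_ae ?_
    filter_upwards [h0, htop] with s hs0 hst
    by_cases hvt : v s = ⊤
    · simp [hst hvt]
    refine le_of_eq ?_
    have h1 : f s ^ (1 - 1 / q) * f s ^ (1 / q) = f s := by
      rw [← ENNReal.rpow_add_of_nonneg _ _ hinv' hinv.le]; simp
    have h2 : v s ^ (1 - 1 / q) * (v s ^ (1 - q)) ^ (1 / q) = 1 := by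
      rw [← ENNReal.rpow_mul, ← ENNReal.rpow_add _ _ hs0 hvt]
      have : 1 - 1 / q + (1 - q) * (1 / q) = 0 := by field_simp; ring
      rw [this, ENNReal.rpow_zero]
    rw [ENNReal.mul_rpow_of_nonneg _ _ hinv', ENNReal.mul_rpow_of_nonneg _ _ hinv.le,
      mul_mul_mul_comm, h1, h2, mul_one]
  have hH := hfac.trans (ENNReal.lintegral_mul_norm_pow_le (hf.mul hv).aemeasurable
    (hf.mul (hv.pow_const (1 - q))).aemeasurable hinv' hinv.le (by ring))
  calc (∫⁻ s, f s ∂μ) ^ q ≤ _ := ENNReal.rpow_le_rpow hH hq0.le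
    _ = _ := by
      rw [ENNReal.mul_rpow_of_nonneg _ _ hq0.le, ← ENNReal.rpow_mul, ← ENNReal.rpow_mul]
      have e1 : (1 - 1 / q) * q = q - 1 := by field_simp
      have e2 : 1 / q * q = 1 := by field_simp
      rw [e1, e2, ENNReal.rpow_one]
      rfl

/-- Necessity: testing the Hardy inequality on the indicator of a set where `1 / v` is large. -/
lemma tail_rpow_mul_essSup_le_of_hardy {q : ℝ} (hq : 1 ≤ q) {v w : ℝ → ℝ≥0∞}
    (hv : Measurable v) {K : ℝ≥0∞}
    (h : ∀ f : ℝ → ℝ≥0∞, Measurable f →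
        (∫⁻ t in Ioi (0 : ℝ), (∫⁻ s in Ioo 0 t, f s) ^ q * w t) ^ (1 / q) ≤
          K * ∫⁻ s in Ioi (0 : ℝ), f s * v s) {t : ℝ} (ht : 0 < t) :
    (∫⁻ s in Ioi t, w s) ^ (1 / q) *
      essSup (fun s => (v s)⁻¹) (volume.restrict (Ioo (0 : ℝ) t)) ≤ K := by
  have hq0 : 0 < q := by linarith
  refine ENNReal.mul_le_of_forall_lt fun a ha c hc => ?_
  refine (mul_le_mul_left ha.le c).trans ?_
  set E : Set ℝ := {s | c < (v s)⁻¹} ∩ Ioo 0 t with hE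
  have hEm : MeasurableSet E := (measurableSet_lt measurable_const hv.inv).inter measurableSet_Ioo
  have hE0 : volume E ≠ 0 := by
    intro h0
    refine not_lt_of_ge (essSup_le_of_ae_le (f := fun s => (v s)⁻¹) c ?_) hc
    rw [Filter.EventuallyLE, ae_restrict_iff' measurableSet_Ioo, ae_iff]
    refine measure_mono_null (fun s hs => ?_) h0
    simp only [mem_ofPred_eq, Classical.not_imp, not_le] at hs
    exact ⟨hs.2, hs.1⟩
  have hEt : volume E ≠ ⊤ :=
    ((measure_mono inter_subset_right).trans_lt measure_Ioo_lt_top).ne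
  have hL : volume E * (∫⁻ s in Ioi t, w s) ^ (1 / q) ≤
      (∫⁻ τ in Ioi (0 : ℝ), (∫⁻ s in Ioo 0 τ, E.indicator 1 s) ^ q * w τ) ^ (1 / q) := by
    calc volume E * (∫⁻ s in Ioi t, w s) ^ (1 / q)
        = (volume E ^ q * ∫⁻ s in Ioi t, w s) ^ (1 / q) := by
          rw [ENNReal.mul_rpow_of_nonneg _ _ (by positivity), ← ENNReal.rpow_mul,
            mul_one_div_cancel hq0.ne', ENNReal.rpow_one]
      _ = (∫⁻ τ in Ioi t, volume E ^ q * w τ) ^ (1 / q) := by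
          rw [lintegral_const_mul' _ _ (ENNReal.rpow_ne_top_of_nonneg hq0.le hEt)]
      _ ≤ _ := by
          refine ENNReal.rpow_le_rpow ?_ (by positivity)
          refine le_trans ?_ (lintegral_mono_set (Ioi_subset_Ioi ht.le))
          refine setLIntegral_mono_ae' measurableSet_Ioi (ae_of_all _ fun τ hτ => ?_)
          refine mul_le_mul_left (ENNReal.rpow_le_rpow ?_ hq0.le) _
          rw [lintegral_indicator_one hEm, Measure.restrict_apply hEm,
            inter_eq_left.2 (inter_subset_right.trans (Ioo_subset_Ioo_right (le_of_lt hτ)))]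
  have hR : ∫⁻ s in Ioi (0 : ℝ), E.indicator 1 s * v s ≤ c⁻¹ * volume E := by
    calc ∫⁻ s in Ioi (0 : ℝ), E.indicator 1 s * v s
        ≤ ∫⁻ s, E.indicator (fun _ => c⁻¹) s := by
          refine (setLIntegral_le_lintegral _ _).trans (lintegral_mono fun s => ?_)
          by_cases hs : s ∈ E
          · simp only [indicator_of_mem hs, Pi.one_apply, one_mul]
            exact ENNReal.le_inv_iff_le_inv.1 (le_of_lt hs.1)
          · simp [indicator_of_notMem hs]
      _ = c⁻¹ * volume E := lintegral_indicator_const hEm _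
  have key := (hL.trans (h _ (measurable_one.indicator hEm))).trans (mul_le_mul_right hR K)
  rw [← mul_assoc, mul_comm (volume E)] at key
  have key' := (ENNReal.mul_le_mul_iff_left hE0 hEt).1 key
  calc (∫⁻ s in Ioi t, w s) ^ (1 / q) * c ≤ K * c⁻¹ * c := mul_le_mul_left key' c
    _ ≤ K := by
      rw [mul_assoc]
      exact mul_le_of_le_one_right' (ENNReal.inv_mul_le_one c)

/-- Sufficiency: the supremum condition gives the Hardy inequality. -/
lemma hardy_of_tail_rpow_mul_essSup_le {q : ℝ} (hq : 1 ≤ q) {v w : ℝ → ℝ≥0∞}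
    (hv : Measurable v) (hw : Measurable w) {K : ℝ≥0∞} (hK0 : K ≠ 0) (hKt : K ≠ ⊤)
    (h : ∀ t : ℝ, 0 < t → (∫⁻ s in Ioi t, w s) ^ (1 / q) *
      essSup (fun s => (v s)⁻¹) (volume.restrict (Ioo (0 : ℝ) t)) ≤ K)
    {f : ℝ → ℝ≥0∞} (hf : Measurable f) :
    (∫⁻ t in Ioi (0 : ℝ), (∫⁻ s in Ioo 0 t, f s) ^ q * w t) ^ (1 / q) ≤
      K * ∫⁻ s in Ioi (0 : ℝ), f s * v s := by
  have hq0 : 0 < q := by linarith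
  have hqi : 0 < 1 / q := by positivity
  set M := ∫⁻ s in Ioi (0 : ℝ), f s * v s with hM
  by_cases hMt : M = ⊤
  · rw [hMt, ENNReal.mul_top hK0]; exact le_top
  have hftop : ∀ᵐ s : ℝ, s ∈ Ioi (0 : ℝ) → v s = ⊤ → f s = 0 := by
    have := ae_lt_top (hf.mul hv) hMt
    filter_upwards [(ae_restrict_iff' measurableSet_Ioi).1 this] with s hs hs0 hvs
    by_contra hfs
    have := hs hs0
    simp [hvs, ENNReal.mul_top hfs] at this
  have hle : ∀ t : ℝ, 0 < t → ∀ᵐ s : ℝ, s ∈ Ioo 0 t →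
      (∫⁻ x in Ioi t, w x) ^ (1 / q) * (v s)⁻¹ ≤ K := by
    intro t ht
    have := ENNReal.ae_le_essSup (μ := volume.restrict (Ioo (0 : ℝ) t)) (fun s => (v s)⁻¹)
    filter_upwards [(ae_restrict_iff' measurableSet_Ioo).1 this] with s hs hst
    exact (mul_le_mul_right (hs hst) _).trans (h t ht)
  have hne : ∀ t : ℝ, 0 < t → ∫⁻ x in Ioi t, w x ≠ 0 →
      ∀ᵐ s ∂(volume.restrict (Ioo (0 : ℝ) t)), v s ≠ 0 := by
    intro t ht hW
    refine (ae_restrict_iff' measurableSet_Ioo).2 ?_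
    filter_upwards [hle t ht] with s hs hst hv0
    have := hs hst
    rw [hv0, ENNReal.inv_zero, ENNReal.mul_top] at this
    · exact hKt (top_le_iff.1 this)
    · simp [ENNReal.rpow_eq_zero_iff, hW, not_lt.2 hq0.le]
  have hWv : ∀ᵐ s : ℝ, s ∈ Ioi (0 : ℝ) → v s ≠ ⊤ →
      ∫⁻ x in Ioi s, w x ≤ K ^ q * v s ^ q := by
    have : ∀ᵐ s : ℝ, ∀ r : ℚ, 0 < (r : ℝ) → s ∈ Ioo 0 (r : ℝ) →
        (∫⁻ x in Ioi (r : ℝ), w x) ^ (1 / q) * (v s)⁻¹ ≤ K := by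
      refine ae_all_iff.2 fun r => ?_
      by_cases hr : 0 < (r : ℝ)
      · filter_upwards [hle r hr] with s hs _ using hs
      · exact ae_of_all _ fun s h' => absurd h' hr
    filter_upwards [this] with s hs hs0 hvt
    refine tail_lintegral_le_of_forall_rat fun r hr => ?_
    have h1 := hs r (lt_trans hs0 hr) ⟨hs0, hr⟩
    rw [← div_eq_mul_inv] at h1
    have h2 : (∫⁻ x in Ioi (r : ℝ), w x) ^ (1 / q) ≤ K * v s :=
      (ENNReal.div_le_iff_le_mul (Or.inr hKt) (Or.inl hvt)).1 h1
    have h3 := ENNReal.rpow_le_rpow h2 hq0.le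
    rwa [← ENNReal.rpow_mul, one_div_mul_cancel hq0.ne', ENNReal.rpow_one,
      ENNReal.mul_rpow_of_nonneg _ _ hq0.le] at h3
  have hg : Measurable fun s => f s * v s ^ (1 - q) := hf.mul (hv.pow_const _)
  have hmain : ∫⁻ t in Ioi (0 : ℝ), (∫⁻ s in Ioo 0 t, f s) ^ q * w t ≤ (K * M) ^ q := by
    calc ∫⁻ t in Ioi (0 : ℝ), (∫⁻ s in Ioo 0 t, f s) ^ q * w t
        ≤ ∫⁻ t in Ioi (0 : ℝ),
            M ^ (q - 1) * ((∫⁻ s in Ioo 0 t, f s * v s ^ (1 - q)) * w t) := by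
          refine setLIntegral_mono_ae' measurableSet_Ioi ?_
          filter_upwards [ae_eq_zero_of_tail_lintegral_eq_zero hw] with t hwt ht
          by_cases hW : ∫⁻ s in Ioi t, w s = 0
          · simp [hwt hW]
          rw [← mul_assoc]
          refine mul_le_mul_left ?_ _
          refine (lintegral_rpow_le_mul_lintegral_mul_rpow hq hf hv (hne t ht hW) ?_).trans ?_
          · refine (ae_restrict_iff' measurableSet_Ioo).2 ?_
            filter_upwards [hftop] with s hs hst using hs hst.1
          · refine mul_le_mul_left (ENNReal.rpow_le_rpow ?_ (by linarith)) _
            exact lintegral_mono_set Ioo_subset_Ioi_self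
      _ = M ^ (q - 1) * ∫⁻ s in Ioi (0 : ℝ), f s * v s ^ (1 - q) * ∫⁻ t in Ioi s, w t := by
          rw [lintegral_const_mul' _ _ (ENNReal.rpow_ne_top_of_nonneg (by linarith) hMt),
            lintegral_Ioo_mul_eq_lintegral_mul_tail hg hw]
      _ ≤ M ^ (q - 1) * ∫⁻ s in Ioi (0 : ℝ), K ^ q * (f s * v s) := by
          refine mul_le_mul_right (setLIntegral_mono_ae' measurableSet_Ioi ?_) _
          filter_upwards [hftop, hWv] with s hfs hWs hs
          by_cases hvt : v s = ⊤
          · simp [hfs hs hvt]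
          by_cases hv0 : v s = 0
          · have := hWs hs hvt
            rw [hv0, ENNReal.zero_rpow_of_pos hq0, mul_zero, nonpos_iff_eq_zero] at this
            simp [this]
          calc f s * v s ^ (1 - q) * ∫⁻ t in Ioi s, w t
              ≤ f s * v s ^ (1 - q) * (K ^ q * v s ^ q) := mul_le_mul_right (hWs hs hvt) _
            _ = K ^ q * (f s * (v s ^ (1 - q) * v s ^ q)) := by ring
            _ = K ^ q * (f s * v s) := by
              rw [← ENNReal.rpow_add _ _ hv0 hvt, sub_add_cancel, ENNReal.rpow_one]
      _ = (K * M) ^ q := by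
          rw [lintegral_const_mul' _ _ (ENNReal.rpow_ne_top_of_nonneg hq0.le hKt), ← hM,
            ENNReal.mul_rpow_of_nonneg _ _ hq0.le, mul_left_comm]
          congr 1
          nth_rewrite 2 [← ENNReal.rpow_one M]
          rw [← ENNReal.rpow_add_of_nonneg _ _ (by linarith) zero_le_one, sub_add_cancel]
  calc _ ≤ ((K * M) ^ q) ^ (1 / q) := ENNReal.rpow_le_rpow hmain hqi.le
    _ = K * M := by rw [← ENNReal.rpow_mul, mul_one_div_cancel hq0.ne', ENNReal.rpow_one]

/-- The two-weight Hardy inequality, convex case `p = 1 ≤ q < ∞`: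
the inequality holds with some positive constant `C` for all nonnegative
measurable `f` iff `sup_{t>0} W(t)^{1/q} · ess sup_{s∈(0,t)} 1/v(s) < ∞`. -/
theorem hardy_convex_case_p_eq_one (q : ℝ) (hq : 1 ≤ q)
    (v w : ℝ → ℝ≥0∞) (hv : Measurable v) (hw : Measurable w) :
    (∃ C : ℝ, 0 < C ∧ ∀ f : ℝ → ℝ≥0∞, Measurable f →
        (∫⁻ t in Ioi (0 : ℝ), (∫⁻ s in Ioo 0 t, f s) ^ q * w t) ^ (1 / q) ≤
          ENNReal.ofReal C * ∫⁻ s in Ioi (0 : ℝ), f s * v s) ↔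
    (⨆ t ∈ Ioi (0 : ℝ), (∫⁻ s in Ioi t, w s) ^ (1 / q) *
        essSup (fun s => (v s)⁻¹) (volume.restrict (Ioo (0 : ℝ) t))) < ⊤ := by
  constructor
  · rintro ⟨C, _, h⟩
    refine lt_of_le_of_lt (iSup₂_le fun t ht => ?_) (ENNReal.ofReal_lt_top (r := C))
    exact tail_rpow_mul_essSup_le_of_hardy hq hv h ht
  · intro hA
    set A := ⨆ t ∈ Ioi (0 : ℝ), (∫⁻ s in Ioi t, w s) ^ (1 / q) *
        essSup (fun s => (v s)⁻¹) (volume.restrict (Ioo (0 : ℝ) t))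
    have hC : 0 < A.toReal + 1 := by positivity
    refine ⟨A.toReal + 1, hC, fun f hf => ?_⟩
    refine hardy_of_tail_rpow_mul_essSup_le hq hv hw (ENNReal.ofReal_pos.2 hC).ne'
      ENNReal.ofReal_ne_top (fun t ht => ?_) hf
    calc _ ≤ A := le_iSup₂ (f := fun (t : ℝ) (_ : t ∈ Ioi (0 : ℝ)) =>
          (∫⁻ s in Ioi t, w s) ^ (1 / q) *
            essSup (fun s => (v s)⁻¹) (volume.restrict (Ioo (0 : ℝ) t))) t ht
      _ = ENNReal.ofReal A.toReal := (ENNReal.ofReal_toReal hA.ne).symm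
      _ ≤ _ := ENNReal.ofReal_le_ofReal (by linarith)
end

section
/- Let 1 < p < ∞, 0 < q < p, set r = pq/(p−q), and let v, w be weights on (0,∞). Then there exists a positive constant C such that the two-weight Hardy inequality holds with constant C for every nonnegative measurable function f on (0,∞) if and only if ∫_0^∞ V(t)^r W(t)^{r/p} w(t) dt < ∞, i.e. ∫_0^∞ (∫_0^t v^{1−p'})^{r/p'} (∫_t^∞ w)^{q/(p−q)} w(t) dt < ∞. -/
open MeasureTheory Set ENNReal

lemma rpow_le_rpow_of_exponent_nonpos {x y : ℝ≥0∞} (h : x ≤ y) {z : ℝ} (hz : z ≤ 0) :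
    y ^ z ≤ x ^ z := by
  rw [← neg_neg z, ENNReal.rpow_neg, ENNReal.rpow_neg x]
  exact ENNReal.inv_le_inv.2 (ENNReal.rpow_le_rpow h (by linarith))

section Distribution

variable {α : Type*} [MeasurableSpace α]

lemma measure_le_of_forall_measure_Iio_le [LinearOrder α] [TopologicalSpace α] [OrderTopology α]
    [SecondCountableTopology α] {μ : Measure α} [NullSingletonClass μ] {A : Set α} {c : ℝ≥0∞}
    (h : ∀ s ∈ A, μ (Iio s) ≤ c) : μ A ≤ c := by
  obtain ⟨T, hTA, hT, hU⟩ :=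
    TopologicalSpace.isOpen_biUnion_countable A (fun s => Iio s) (fun _ _ => isOpen_Iio)
  have h0 : μ (A \ ⋃ s ∈ A, Iio s) = 0 := by
    refine Set.Subsingleton.measure_zero (fun x hx y hy => ?_) μ
    simp only [mem_sdiff, mem_iUnion, mem_Iio, exists_prop, not_exists, not_and, not_lt] at hx hy
    exact le_antisymm (hy.2 x hx.1) (hx.2 y hy.1)
  have h1 : μ (⋃ s ∈ T, Iio s) ≤ c := by
    rw [measure_biUnion_eq_iSup hT]
    · exact iSup₂_le fun s hs => h s (hTA hs)
    · intro x hx y hy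
      rcases le_total x y with hxy | hxy
      · exact ⟨y, hy, Iio_subset_Iio hxy, subset_rfl⟩
      · exact ⟨x, hx, subset_rfl, Iio_subset_Iio hxy⟩
  calc μ A ≤ μ ((A \ ⋃ s ∈ A, Iio s) ∪ ⋃ s ∈ A, Iio s) := by
        refine measure_mono ?_
        rw [sdiff_union_self]; exact subset_union_left
    _ ≤ μ (A \ ⋃ s ∈ A, Iio s) + μ (⋃ s ∈ A, Iio s) := measure_union_le _ _
    _ ≤ c := by rw [h0, zero_add, ← hU]; exact h1

lemma measure_le_of_forall_measure_Ioi_le [LinearOrder α] [TopologicalSpace α] [OrderTopology α]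
    [SecondCountableTopology α] {μ : Measure α} [hμ : NullSingletonClass μ] {A : Set α} {c : ℝ≥0∞}
    (h : ∀ s ∈ A, μ (Ioi s) ≤ c) : μ A ≤ c :=
  @measure_le_of_forall_measure_Iio_le αᵒᵈ _ _ _ _ _ μ hμ A c h

variable {μ : Measure α} {g : α → ℝ≥0∞}

lemma measure_univ_rpow_le_lintegral_rpow (hg : Measurable g)
    (h : ∀ c, μ {x | g x ≤ c} ≤ c) {a : ℝ} (ha : 0 ≤ a) :
    μ univ ^ (a + 1) ≤ 2 ^ (a + 1) * ∫⁻ x, g x ^ a ∂μ := by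
  have ha1 : 0 < a + 1 := by linarith
  have key : ∀ c : ℝ≥0∞, c ≠ ∞ → c ≤ μ univ → (c / 2) ^ (a + 1) ≤ ∫⁻ x, g x ^ a ∂μ := by
    intro c hc hcM
    have hc2 : c / 2 ≠ ∞ := (ENNReal.div_lt_top hc (by simp)).ne
    have h1 : c / 2 ≤ μ {x | c / 2 ≤ g x} := by
      have h2 : c / 2 + c / 2 ≤ c / 2 + μ {x | c / 2 ≤ g x} := by
        calc c / 2 + c / 2 = c := ENNReal.add_halves c
          _ ≤ μ univ := hcM
          _ ≤ μ ({x | g x ≤ c / 2} ∪ {x | c / 2 ≤ g x}) :=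
            measure_mono fun x _ => le_total (g x) (c / 2)
          _ ≤ _ := measure_union_le _ _
          _ ≤ _ := by gcongr; exact h _
      exact (ENNReal.add_le_add_iff_left hc2).1 h2
    calc (c / 2) ^ (a + 1) = (c / 2) ^ a * (c / 2) := by
          rw [ENNReal.rpow_add_of_nonneg _ _ ha zero_le_one, ENNReal.rpow_one]
      _ ≤ (c / 2) ^ a * μ {x | (c / 2) ^ a ≤ g x ^ a} := by
          gcongr
          refine h1.trans (measure_mono fun x hx => ?_)
          exact ENNReal.rpow_le_rpow hx ha
      _ ≤ _ := mul_meas_ge_le_lintegral (hg.pow_const a) _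
  have h2 : μ univ ≤ 2 * (∫⁻ x, g x ^ a ∂μ) ^ (1 / (a + 1)) := by
    refine ENNReal.le_of_forall_nnreal_lt fun c hc => ?_
    have h3 := ENNReal.rpow_le_rpow (key c ENNReal.coe_ne_top hc.le)
      (by positivity : 0 ≤ 1 / (a + 1))
    rw [← ENNReal.rpow_mul, mul_one_div_cancel ha1.ne', ENNReal.rpow_one] at h3
    calc (c : ℝ≥0∞) = 2 * (c / 2) := (ENNReal.mul_div_cancel (by simp) (by simp)).symm
      _ ≤ _ := by gcongr
  calc μ univ ^ (a + 1) ≤ (2 * (∫⁻ x, g x ^ a ∂μ) ^ (1 / (a + 1))) ^ (a + 1) := by gcongr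
    _ = _ := by
      rw [ENNReal.mul_rpow_of_nonneg _ _ ha1.le, ← ENNReal.rpow_mul, one_div_mul_cancel ha1.ne',
        ENNReal.rpow_one]

lemma rpow_sub_one_le_tsum_dyadic {γ : ℝ} (hγ1 : γ < 1) {M x : ℝ≥0∞} (hM : M ≠ ∞) (hx0 : x ≠ 0)
    (hxM : x ≤ M) :
    x ^ (γ - 1) ≤ ∑' k : ℕ,
      (Iic (2⁻¹ ^ k * M)).indicator (fun _ => (2⁻¹ ^ (k + 1) * M) ^ (γ - 1)) x := by
  have hM0 : M ≠ 0 := fun h => hx0 (le_antisymm (h ▸ hxM) zero_le)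
  have hex : ∃ k : ℕ, 2⁻¹ ^ k * M < x := by
    obtain ⟨k, hk⟩ := ((ENNReal.tendsto_pow_atTop_nhds_zero_of_lt_one (r := 2⁻¹)
      (by simp)).eventually_lt_const (ENNReal.div_pos hx0 hM)).exists
    exact ⟨k, (ENNReal.lt_div_iff_mul_lt (Or.inl hM0) (Or.inl hM)).1 hk⟩
  classical
  have hspec := Nat.find_spec hex
  have hpos : Nat.find hex ≠ 0 := by
    intro h0
    rw [h0] at hspec
    simp only [pow_zero, one_mul] at hspec
    exact absurd hspec (not_lt.2 hxM)
  obtain ⟨k, hk⟩ := Nat.exists_eq_succ_of_ne_zero hpos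
  have hmin : x ≤ 2⁻¹ ^ k * M := not_lt.1 (Nat.find_min hex (by omega))
  rw [hk] at hspec
  refine le_trans ?_ (ENNReal.le_tsum k)
  rw [indicator_of_mem (by exact hmin)]
  exact rpow_le_rpow_of_exponent_nonpos hspec.le (by linarith)

lemma exists_lintegral_rpow_sub_one_le {γ : ℝ} (hγ : 0 < γ) :
    ∃ K : ℝ≥0∞, K ≠ ∞ ∧ ∀ (μ : Measure α) (g : α → ℝ≥0∞) (M : ℝ≥0∞), Measurable g →
      (∀ c, μ {x | g x ≤ c} ≤ c) → M ≠ ∞ → (∀ᵐ x ∂μ, g x ≤ M) →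
      ∫⁻ x, g x ^ (γ - 1) ∂μ ≤ K * M ^ γ := by
  rcases le_or_gt 1 γ with hγ1 | hγ1
  · refine ⟨1, by simp, fun μ g M hg h hM hgM => ?_⟩
    have hu : μ univ ≤ M := by
      exact (measure_mono_ae (hgM.mono fun x hx _ => hx)).trans (h M)
    calc ∫⁻ x, g x ^ (γ - 1) ∂μ ≤ ∫⁻ x, M ^ (γ - 1) ∂μ := by
          refine lintegral_mono_ae (hgM.mono fun x hx => ?_)
          exact ENNReal.rpow_le_rpow hx (by linarith)
      _ = M ^ (γ - 1) * μ univ := lintegral_const _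
      _ ≤ M ^ (γ - 1) * M ^ (1 : ℝ) := by rw [ENNReal.rpow_one]; gcongr
      _ = 1 * M ^ γ := by
          rw [← ENNReal.rpow_add_of_nonneg _ _ (by linarith) zero_le_one, sub_add_cancel, one_mul]
  · refine ⟨∑' k : ℕ, (2⁻¹ : ℝ≥0∞) ^ (γ - 1) * ((2⁻¹ : ℝ≥0∞) ^ γ) ^ k, ?_,
      fun μ g M hg h hM hgM => ?_⟩
    · rw [ENNReal.tsum_mul_left, ENNReal.tsum_geometric]
      refine ENNReal.mul_ne_top (ENNReal.rpow_ne_top_of_ne_zero (by simp) (by simp)) ?_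
      simp only [ne_eq, ENNReal.inv_eq_top]
      exact (tsub_pos_of_lt (ENNReal.rpow_lt_one (by simp) hγ)).ne'
    have h0 : ∀ᵐ x ∂μ, g x ≠ 0 := by
      have := h 0
      rw [ae_iff]
      simpa using this
    have hmeas : ∀ k : ℕ, MeasurableSet {x | g x ≤ 2⁻¹ ^ k * M} := fun k =>
      measurableSet_le hg measurable_const
    calc ∫⁻ x, g x ^ (γ - 1) ∂μ
        ≤ ∫⁻ x, ∑' k : ℕ, {x | g x ≤ 2⁻¹ ^ k * M}.indicator
            (fun _ => (2⁻¹ ^ (k + 1) * M) ^ (γ - 1)) x ∂μ := by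
          refine lintegral_mono_ae ?_
          filter_upwards [h0, hgM] with x hx hxM
          exact rpow_sub_one_le_tsum_dyadic hγ1 hM hx hxM
      _ = ∑' k : ℕ, (2⁻¹ ^ (k + 1) * M) ^ (γ - 1) * μ {x | g x ≤ 2⁻¹ ^ k * M} := by
          rw [lintegral_tsum fun k => (measurable_const.indicator (hmeas k)).aemeasurable]
          congr 1; ext k
          rw [lintegral_indicator_const (hmeas k)]
      _ ≤ ∑' k : ℕ, (2⁻¹ ^ (k + 1) * M) ^ (γ - 1) * (2⁻¹ ^ k * M) := by
          gcongr with k; exact h _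
      _ ≤ ∑' k : ℕ, (2⁻¹ : ℝ≥0∞) ^ (γ - 1) * ((2⁻¹ : ℝ≥0∞) ^ γ) ^ k * M ^ γ := by
          refine ENNReal.tsum_le_tsum fun k => ?_
          rcases eq_or_ne M 0 with rfl | hM0
          · simp
          have h2 : (2⁻¹ : ℝ≥0∞) ^ k ≠ 0 := by simp
          have h2t : (2⁻¹ : ℝ≥0∞) ^ k ≠ ∞ := ENNReal.pow_ne_top (by simp)
          have h3 : (2⁻¹ : ℝ≥0∞) ^ k * M ≠ 0 := mul_ne_zero h2 hM0
          have h3t : (2⁻¹ : ℝ≥0∞) ^ k * M ≠ ∞ := ENNReal.mul_ne_top h2t hM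
          have e1 : (2⁻¹ : ℝ≥0∞) ^ (k + 1) * M = 2⁻¹ * (2⁻¹ ^ k * M) := by ring
          rw [e1, ENNReal.mul_rpow_of_ne_zero (by simp) h3, mul_assoc, mul_assoc]
          refine le_of_eq ?_
          congr 1
          calc ((2⁻¹ : ℝ≥0∞) ^ k * M) ^ (γ - 1) * (2⁻¹ ^ k * M)
              = ((2⁻¹ : ℝ≥0∞) ^ k * M) ^ (γ - 1) * (2⁻¹ ^ k * M) ^ (1 : ℝ) := by
                rw [ENNReal.rpow_one]
            _ = ((2⁻¹ : ℝ≥0∞) ^ k * M) ^ γ := by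
                rw [← ENNReal.rpow_add _ _ h3 h3t, sub_add_cancel]
            _ = _ := by
                rw [ENNReal.mul_rpow_of_ne_zero h2 hM0, ← ENNReal.rpow_natCast,
                  ← ENNReal.rpow_natCast, ← ENNReal.rpow_mul, ← ENNReal.rpow_mul, mul_comm γ]
      _ = _ := ENNReal.tsum_mul_right

end Distribution

section Sufficiency

lemma lintegral_le_rpow_mul_rpow_weight {α : Type*} [MeasurableSpace α] {μ : Measure α}
    {p p' : ℝ} (hpp : p.HolderConjugate p') {f v : α → ℝ≥0∞} (hf : Measurable f)
    (hv : Measurable v) (h1 : ∫⁻ x, f x ^ p * v x ∂μ ≠ ∞)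
    (h2 : ∫⁻ x, v x ^ (1 - p') ∂μ ≠ ∞) :
    ∫⁻ x, f x ∂μ ≤
      (∫⁻ x, f x ^ p * v x ∂μ) ^ (1 / p) * (∫⁻ x, v x ^ (1 - p') ∂μ) ^ (1 / p') := by
  have hp : 0 < p := hpp.pos
  have hp' : 1 < p' := hpp.symm.lt
  have hmul : p'/p = p' - 1 := by
    have := hpp.symm.sub_one_mul_conj
    rw [div_eq_iff hp.ne']; linarith
  have e1 : ∀ᵐ x ∂μ, f x ≤ ((fun x => f x * v x ^ (1 / p)) * fun x => v x ^ (-(1 / p))) x := by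
    filter_upwards [ae_lt_top ((hf.pow_const p).mul hv) h1, ae_lt_top (hv.pow_const _) h2]
      with x hx1 hx2
    have hv0 : v x ≠ 0 := by
      intro h
      rw [h, ENNReal.zero_rpow_of_neg (by linarith)] at hx2
      exact lt_irrefl _ hx2
    by_cases hvt : v x = ∞
    · have : f x = 0 := by
        by_contra h
        rw [Pi.mul_apply, hvt, ENNReal.mul_top (by simp [ENNReal.rpow_eq_zero_iff, h, hp.le])] at hx1
        exact lt_irrefl _ hx1
      simp [this]
    · rw [Pi.mul_apply, mul_assoc, ← ENNReal.rpow_add _ _ hv0 hvt]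
      simp
  refine (lintegral_mono_ae e1).trans ?_
  refine (ENNReal.lintegral_mul_le_Lp_mul_Lq μ hpp
    (hf.mul (hv.pow_const _)).aemeasurable (hv.pow_const _).aemeasurable).trans (le_of_eq ?_)
  congr 3
  · ext x
    rw [Pi.mul_apply, ENNReal.mul_rpow_of_nonneg _ _ hp.le, ← ENNReal.rpow_mul,
      one_div_mul_cancel hp.ne', ENNReal.rpow_one]
  · ext x
    rw [← ENNReal.rpow_mul]
    congr 1
    rw [neg_mul, one_div_mul_eq_div, hmul]; ring

lemma tsum_rpow_mul_rpow_le {ι : Type*} (a b : ι → ℝ≥0∞) {x y : ℝ}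
    (hx : 0 ≤ x) (hy : 0 ≤ y) (hxy : x + y = 1) :
    ∑' k, a k ^ x * b k ^ y ≤ (∑' k, a k) ^ x * (∑' k, b k) ^ y := by
  let : MeasurableSpace ι := ⊤
  have : DiscreteMeasurableSpace ι := ⟨fun _ => trivial⟩
  simpa only [lintegral_count] using ENNReal.lintegral_mul_norm_pow_le (μ := Measure.count)
    (Measurable.of_discrete (f := a)).aemeasurable (Measurable.of_discrete (f := b)).aemeasurable
    hx hy hxy

lemma zpow_Ioc_eq {x : ℝ≥0∞} {i j : ℤ} (hi : x ∈ Ioc ((2 : ℝ≥0∞) ^ i) (2 ^ (i + 1)))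
    (hj : x ∈ Ioc ((2 : ℝ≥0∞) ^ j) (2 ^ (j + 1))) : i = j := by
  have key : ∀ i j : ℤ, x ∈ Ioc ((2 : ℝ≥0∞) ^ i) (2 ^ (i + 1)) →
      x ∈ Ioc ((2 : ℝ≥0∞) ^ j) (2 ^ (j + 1)) → ¬ i < j := fun i j hi hj hij =>
    absurd (hj.1.trans_le hi.2) (not_lt.2 (ENNReal.zpow_le_of_le (by norm_num) (by omega)))
  have h1 := key i j hi hj
  have h2 := key j i hj hi
  omega

lemma measurable_setLIntegral_Iio (m : Measure ℝ) (f : ℝ → ℝ≥0∞) :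
    Measurable fun t => ∫⁻ s in Iio t, f s ∂m :=
  Monotone.measurable fun _ _ h => lintegral_mono_set (Iio_subset_Iio h)

lemma measurable_setLIntegral_Ioi (m : Measure ℝ) (f : ℝ → ℝ≥0∞) :
    Measurable fun t => ∫⁻ s in Ioi t, f s ∂m :=
  Antitone.measurable fun _ _ h => lintegral_mono_set (Ioi_subset_Ioi h)

lemma withDensity_setOf_Iio_le (m : Measure ℝ) [NullSingletonClass m] (f : ℝ → ℝ≥0∞) (c : ℝ≥0∞) :
    m.withDensity f {t | ∫⁻ s in Iio t, f s ∂m ≤ c} ≤ c :=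
  measure_le_of_forall_measure_Iio_le fun s hs => by
    rw [withDensity_apply _ measurableSet_Iio]; exact hs

lemma withDensity_setOf_Ioi_le (m : Measure ℝ) [NullSingletonClass m] (f : ℝ → ℝ≥0∞) (c : ℝ≥0∞) :
    m.withDensity f {t | ∫⁻ s in Ioi t, f s ∂m ≤ c} ≤ c :=
  measure_le_of_forall_measure_Ioi_le fun s hs => by
    rw [withDensity_apply _ measurableSet_Ioi]; exact hs

lemma zpow_le_rpow_mul_rpow_of_mem (m : Measure ℝ) [NullSingletonClass m] {p p' : ℝ}
    (hpp : p.HolderConjugate p') {f v : ℝ → ℝ≥0∞} (hf : Measurable f) (hv : Measurable v)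
    (hA : ∫⁻ s, f s ^ p * v s ∂m ≠ ∞) (D : ℤ → Set ℝ)
    (hD : ∀ k, D k = {t | ∫⁻ s in Iio t, f s ∂m ∈ Ioc ((2 : ℝ≥0∞) ^ k) (2 ^ (k + 1))})
    {k : ℤ} {t : ℝ} (ht : t ∈ D k) (hS : ∫⁻ s in Iio t, v s ^ (1 - p') ∂m ≠ ∞) :
    (2 : ℝ≥0∞) ^ (k + 1) ≤
      4 * (((∫⁻ s in D (k - 1), f s ^ p * v s ∂m) + ∫⁻ s in D k, f s ^ p * v s ∂m) ^ (1 / p) *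
        (∫⁻ s in Iio t, v s ^ (1 - p') ∂m) ^ (1 / p')) := by
  set F : ℝ → ℝ≥0∞ := fun t => ∫⁻ s in Iio t, f s ∂m with hF
  have hFm : Measurable F := measurable_setLIntegral_Iio m f
  have hFmono : Monotone F := fun _ _ h => lintegral_mono_set (Iio_subset_Iio h)
  rw [hD] at ht
  obtain ⟨ht1, ht2⟩ := ht
  have e2 : (2 : ℝ≥0∞) ^ k = 2 ^ (k - 1) + 2 ^ (k - 1) := by
    rw [← two_mul]
    conv_lhs => rw [show k = 1 + (k - 1) by ring]
    rw [ENNReal.zpow_add (by simp) (by simp), zpow_one]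
  have e4 : (2 : ℝ≥0∞) ^ (k + 1) = 4 * 2 ^ (k - 1) := by
    rw [ENNReal.zpow_add (by simp) (by simp), zpow_one, e2]; ring
  set L : Set ℝ := {s | F s ≤ 2 ^ (k - 1)} with hL
  have hLm : MeasurableSet L := measurableSet_le hFm measurable_const
  have h1 : ∫⁻ s in L, f s ∂m ≤ 2 ^ (k - 1) := by
    rw [← withDensity_apply _ hLm]
    exact withDensity_setOf_Iio_le m f _
  have hsub : Iio t ∩ Lᶜ ⊆ D (k - 1) ∪ D k := by
    rintro s ⟨hst, hs⟩
    have hs1 : (2 : ℝ≥0∞) ^ (k - 1) < F s := not_le.1 hs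
    have hs2 : F s ≤ 2 ^ (k + 1) := (hFmono (le_of_lt hst)).trans ht2
    rw [hD, hD]
    rcases le_or_gt (F s) (2 ^ k) with h | h
    · left; exact ⟨hs1, by rwa [sub_add_cancel]⟩
    · right; exact ⟨h, hs2⟩
  have h2 : (2 : ℝ≥0∞) ^ (k - 1) ≤ ∫⁻ s in Iio t ∩ Lᶜ, f s ∂m := by
    have h3 : (2 : ℝ≥0∞) ^ (k - 1) + 2 ^ (k - 1) ≤ 2 ^ (k - 1) + ∫⁻ s in Iio t ∩ Lᶜ, f s ∂m := by
      rw [← e2]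
      refine ht1.le.trans ?_
      calc ∫⁻ s in Iio t, f s ∂m ≤ ∫⁻ s in L ∪ (Iio t ∩ Lᶜ), f s ∂m := by
            refine lintegral_mono_set fun s hs => ?_
            by_cases h : s ∈ L
            · exact Or.inl h
            · exact Or.inr ⟨hs, h⟩
        _ ≤ (∫⁻ s in L, f s ∂m) + ∫⁻ s in Iio t ∩ Lᶜ, f s ∂m := lintegral_union_le _ _ _
        _ ≤ _ := by gcongr
    refine (ENNReal.add_le_add_iff_left ?_).1 h3
    exact (ENNReal.zpow_lt_top (by simp) (by simp) _).ne
  rw [e4]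
  gcongr
  refine h2.trans ?_
  have hAs : ∫⁻ s in Iio t ∩ Lᶜ, f s ^ p * v s ∂m ≠ ∞ :=
    ne_top_of_le_ne_top hA (setLIntegral_le_lintegral _ _)
  have hSs : ∫⁻ s in Iio t ∩ Lᶜ, v s ^ (1 - p') ∂m ≠ ∞ :=
    ne_top_of_le_ne_top hS (lintegral_mono_set inter_subset_left)
  refine (lintegral_le_rpow_mul_rpow_weight hpp hf hv hAs hSs).trans ?_
  have hp := hpp.pos
  have hp' := hpp.symm.pos
  gcongr
  · exact (lintegral_mono_set hsub).trans (lintegral_union_le _ _ _)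
  · exact inter_subset_left

lemma lintegral_rpow_le_of_lintegral_ne_top (m : Measure ℝ) [NullSingletonClass m] {p q r p' : ℝ}
    (hpp : p.HolderConjugate p') (hq : 0 < q) (hr : 0 < r) (hqr : 1 / r = 1 / q - 1 / p)
    {f v w : ℝ → ℝ≥0∞} (hf : Measurable f) (hv : Measurable v)
    (hA : ∫⁻ s, f s ^ p * v s ∂m ≠ ∞)
    (hB : ∫⁻ t, (∫⁻ s in Iio t, v s ^ (1 - p') ∂m) ^ (r / p') * (∫⁻ s in Ioi t, w s ∂m) ^ (r / p)
      ∂(m.withDensity w) ≠ ∞) :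
    ∫⁻ t, (∫⁻ s in Iio t, f s ∂m) ^ q ∂(m.withDensity w) ≤
      2 * 4 ^ q * ((2 * ∫⁻ s, f s ^ p * v s ∂m) ^ (q / p) *
        (∫⁻ t, (∫⁻ s in Iio t, v s ^ (1 - p') ∂m) ^ (r / p') *
          (∫⁻ s in Ioi t, w s ∂m) ^ (r / p) ∂(m.withDensity w)) ^ (q / r)) := by
  have hp := hpp.pos
  have hp' := hpp.symm.pos
  set F : ℝ → ℝ≥0∞ := fun t => ∫⁻ s in Iio t, f s ∂m with hF
  set S : ℝ → ℝ≥0∞ := fun t => ∫⁻ s in Iio t, v s ^ (1 - p') ∂m with hS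
  set W : ℝ → ℝ≥0∞ := fun t => ∫⁻ s in Ioi t, w s ∂m with hW
  set μ := m.withDensity w with hμ
  have hFm : Measurable F := measurable_setLIntegral_Iio m f
  have hSm : Measurable S := measurable_setLIntegral_Iio m _
  have hWm : Measurable W := measurable_setLIntegral_Ioi m w
  have hSWm : Measurable fun t => S t ^ (r / p') * W t ^ (r / p) :=
    (hSm.pow_const _).mul (hWm.pow_const _)
  have hrq : r / p + 1 = r / q := by
    have : r / q - r / p = 1 := by
      rw [div_eq_mul_one_div r q, div_eq_mul_one_div r p, ← mul_sub, ← hqr, mul_one_div_cancel hr.ne']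
    linarith
  have hqpr : q / p + q / r = 1 := by
    rw [div_eq_mul_one_div q r, hqr, mul_sub, mul_one_div_cancel hq.ne']; ring
  have hSfin : ∀ᵐ t ∂μ, S t ≠ ∞ := by
    have hW0 : ∀ᵐ t ∂μ, W t ≠ 0 := by
      rw [ae_iff]
      simpa using withDensity_setOf_Ioi_le m w 0
    filter_upwards [hW0, ae_lt_top hSWm hB] with t h0 ht hSt
    rw [hSt, ENNReal.top_rpow_of_pos (by positivity), ENNReal.top_mul] at ht
    · exact lt_irrefl _ ht
    · have : 0 ≤ r / p := by positivity
      simp [ENNReal.rpow_eq_zero_iff, h0, this]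
  set D : ℤ → Set ℝ := fun k => {t | F t ∈ Ioc ((2 : ℝ≥0∞) ^ k) (2 ^ (k + 1))} with hD
  set E : ℤ → Set ℝ := fun k => D k ∩ {t | S t ≠ ∞} with hE
  have hDm : ∀ k, MeasurableSet (D k) := fun k => hFm measurableSet_Ioc
  have hEm : ∀ k, MeasurableSet (E k) := fun k =>
    (hDm k).inter (hSm (measurableSet_singleton ∞).compl)
  have hDd : Pairwise (Function.onFun Disjoint D) := fun i j hij =>
    Set.disjoint_left.2 fun t hi hj => hij (zpow_Ioc_eq hi hj)
  have hEd : Pairwise (Function.onFun Disjoint E) := fun i j hij =>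
    (hDd hij).mono inter_subset_left inter_subset_left
  set a : ℤ → ℝ≥0∞ := fun k =>
    (∫⁻ s in D (k - 1), f s ^ p * v s ∂m) + ∫⁻ s in D k, f s ^ p * v s ∂m with ha
  set b : ℤ → ℝ≥0∞ := fun k => ∫⁻ t in E k, S t ^ (r / p') * W t ^ (r / p) ∂μ with hb
  have hpiece : ∀ k, ∫⁻ t in E k, F t ^ q ∂μ ≤ 2 * 4 ^ q * (a k ^ (q / p) * b k ^ (q / r)) := by
    intro k
    have h1 : ∫⁻ t in E k, F t ^ q ∂μ ≤ (2 ^ (k + 1)) ^ q * μ (E k) := by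
      rw [← setLIntegral_const]
      refine setLIntegral_mono' (hEm k) fun t ht => ?_
      exact ENNReal.rpow_le_rpow ht.1.2 hq.le
    have h2 : μ (E k) ^ (r / q) ≤ 2 ^ (r / q) * ∫⁻ t in E k, W t ^ (r / p) ∂μ := by
      have := measure_univ_rpow_le_lintegral_rpow (μ := μ.restrict (E k)) hWm
        (fun c => (Measure.restrict_apply_le _ _).trans (withDensity_setOf_Ioi_le m w c))
        (a := r / p) (by positivity)
      rwa [Measure.restrict_apply_univ, hrq] at this
    have h3 : (2 ^ (k + 1)) ^ r * μ (E k) ^ (r / q) ≤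
        2 ^ (r / q) * (4 ^ r * a k ^ (r / p)) * b k := by
      calc (2 ^ (k + 1)) ^ r * μ (E k) ^ (r / q)
          ≤ (2 ^ (k + 1)) ^ r * (2 ^ (r / q) * ∫⁻ t in E k, W t ^ (r / p) ∂μ) := by gcongr
        _ = 2 ^ (r / q) * ∫⁻ t in E k, (2 ^ (k + 1)) ^ r * W t ^ (r / p) ∂μ := by
            rw [lintegral_const_mul _ (hWm.pow_const _)]; ring
        _ ≤ 2 ^ (r / q) * ∫⁻ t in E k,
              (4 ^ r * a k ^ (r / p)) * (S t ^ (r / p') * W t ^ (r / p)) ∂μ := by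
            refine mul_le_mul_right (setLIntegral_mono' (hEm k) fun t ht => ?_) _
            have h4 := zpow_le_rpow_mul_rpow_of_mem m hpp hf hv hA D (fun _ => rfl) ht.1 ht.2
            have h5 := ENNReal.rpow_le_rpow h4 hr.le
            rw [ENNReal.mul_rpow_of_nonneg _ _ hr.le, ENNReal.mul_rpow_of_nonneg _ _ hr.le,
              ← ENNReal.rpow_mul, ← ENNReal.rpow_mul, one_div_mul_eq_div, one_div_mul_eq_div] at h5
            calc _ ≤ _ := mul_le_mul_left h5 _
              _ = _ := by ring
        _ = _ := by
            rw [lintegral_const_mul _ hSWm]; ring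
    have h4 := ENNReal.rpow_le_rpow h3 (by positivity : 0 ≤ q / r)
    have hqr0 : 0 ≤ q / r := by positivity
    have c1 : r * (q / r) = q := by field_simp
    have c2 : r / q * (q / r) = 1 := by field_simp
    have c3 : r / p * (q / r) = q / p := by field_simp
    simp only [ENNReal.mul_rpow_of_nonneg _ _ hqr0, ← ENNReal.rpow_mul, c1, c2, c3,
      ENNReal.rpow_one] at h4
    refine h1.trans (h4.trans (le_of_eq (by ring)))
  have hcover : ∫⁻ t, F t ^ q ∂μ ≤ ∑' k, ∫⁻ t in E k, F t ^ q ∂μ := by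
    rw [← lintegral_iUnion hEm hEd, ← lintegral_indicator (MeasurableSet.iUnion hEm)]
    refine lintegral_mono_ae ?_
    filter_upwards [hSfin] with t ht
    by_cases h0 : F t = 0
    · simp [h0, hq]
    have hFt : F t ≠ ∞ := by
      have hAs : ∫⁻ s in Iio t, f s ^ p * v s ∂m ≠ ∞ :=
        ne_top_of_le_ne_top hA (setLIntegral_le_lintegral _ _)
      refine ne_top_of_le_ne_top ?_ (lintegral_le_rpow_mul_rpow_weight hpp hf hv hAs ht)
      exact ENNReal.mul_ne_top (ENNReal.rpow_ne_top_of_nonneg (by positivity) hAs)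
        (ENNReal.rpow_ne_top_of_nonneg (by positivity) ht)
    obtain ⟨k, hk⟩ := ENNReal.exists_mem_Ioc_zpow h0 hFt (y := 2) (by norm_num) (by simp)
    have hmem : t ∈ ⋃ k, E k := mem_iUnion.2 ⟨k, hk, ht⟩
    rw [indicator_of_mem hmem]
  have hsuma : ∑' k, a k ≤ 2 * ∫⁻ s, f s ^ p * v s ∂m := by
    have h1 : ∑' k, ∫⁻ s in D k, f s ^ p * v s ∂m ≤ ∫⁻ s, f s ^ p * v s ∂m := by
      rw [← lintegral_iUnion hDm hDd]; exact setLIntegral_le_lintegral _ _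
    have h2 := (Equiv.subRight (1 : ℤ)).tsum_eq fun k => ∫⁻ s in D k, f s ^ p * v s ∂m
    simp only [Equiv.subRight_apply] at h2
    rw [ha, ENNReal.tsum_add, h2, two_mul]
    gcongr
  have hsumb : ∑' k, b k ≤ ∫⁻ t, S t ^ (r / p') * W t ^ (r / p) ∂μ := by
    rw [hb, ← lintegral_iUnion hEm hEd]; exact setLIntegral_le_lintegral _ _
  calc ∫⁻ t, F t ^ q ∂μ ≤ ∑' k, ∫⁻ t in E k, F t ^ q ∂μ := hcover
    _ ≤ ∑' k, 2 * 4 ^ q * (a k ^ (q / p) * b k ^ (q / r)) := ENNReal.tsum_le_tsum hpiece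
    _ = 2 * 4 ^ q * ∑' k, a k ^ (q / p) * b k ^ (q / r) := ENNReal.tsum_mul_left
    _ ≤ 2 * 4 ^ q * ((∑' k, a k) ^ (q / p) * (∑' k, b k) ^ (q / r)) := by
        gcongr
        exact tsum_rpow_mul_rpow_le a b (by positivity) (by positivity) hqpr
    _ ≤ _ := by gcongr

end Sufficiency

section Necessity

lemma measure_univ_rpow_le_lintegral_rpow_sub_one {α : Type*} [MeasurableSpace α] {μ : Measure α}
    [IsFiniteMeasure μ] {g : α → ℝ≥0∞} (hg : Measurable g) (h : ∀ c, μ {x | g x ≤ c} ≤ c)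
    (hgM : ∀ᵐ x ∂μ, g x ≤ μ univ) {β : ℝ} (hβ : 0 < β) :
    μ univ ^ β ≤ 2 ^ β * ∫⁻ x, g x ^ (β - 1) ∂μ := by
  rcases le_or_gt 1 β with hβ1 | hβ1
  · simpa using measure_univ_rpow_le_lintegral_rpow hg h (a := β - 1) (by linarith)
  rcases eq_or_ne (μ univ) 0 with h0 | h0
  · simp [h0, hβ]
  calc μ univ ^ β = μ univ ^ (β - 1) * μ univ := by
        conv_rhs => rw [← ENNReal.rpow_one (μ univ), ← ENNReal.rpow_mul, one_mul,
          ← ENNReal.rpow_add _ _ h0 (measure_ne_top μ univ), sub_add_cancel]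
    _ = ∫⁻ _, μ univ ^ (β - 1) ∂μ := (lintegral_const _).symm
    _ ≤ ∫⁻ x, g x ^ (β - 1) ∂μ := lintegral_mono_ae <| hgM.mono fun x hx =>
        rpow_le_rpow_of_exponent_nonpos hx (by linarith)
    _ ≤ 2 ^ β * ∫⁻ x, g x ^ (β - 1) ∂μ :=
        le_mul_of_one_le_left zero_le (ENNReal.one_le_rpow (by norm_num) hβ)

lemma measurable_measure_Iio (ν : Measure ℝ) : Measurable fun t => ν (Iio t) :=
  Monotone.measurable fun _ _ h => measure_mono (Iio_subset_Iio h)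

lemma measurable_measure_Ioi (μ : Measure ℝ) : Measurable fun t => μ (Ioi t) :=
  Antitone.measurable fun _ _ h => measure_mono (Ioi_subset_Ioi h)

lemma exists_lintegral_rpow_mul_rpow_le {a γ : ℝ} (ha : 0 ≤ a) (hγ : 0 < γ) :
    ∃ K : ℝ≥0∞, K ≠ ∞ ∧ ∀ (μ ν : Measure ℝ) [IsFiniteMeasure μ] [IsFiniteMeasure ν]
      [NullSingletonClass μ] [NullSingletonClass ν],
      ∫⁻ s, μ (Ioi s) ^ (a + 1) * ν (Iio s) ^ (γ - 1) ∂ν ≤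
        K * ∫⁻ t, ν (Iio t) ^ γ * μ (Ioi t) ^ a ∂μ := by
  obtain ⟨K, hK, hKle⟩ := exists_lintegral_rpow_sub_one_le (α := ℝ) hγ
  refine ⟨2 ^ (a + 1) * K, ENNReal.mul_ne_top (by simp) hK, fun μ ν _ _ _ _ => ?_⟩
  have hWm := measurable_measure_Ioi μ
  have hSm := measurable_measure_Iio ν
  have hW : ∀ s, μ (Ioi s) ^ (a + 1) ≤ 2 ^ (a + 1) * ∫⁻ t in Ioi s, μ (Ioi t) ^ a ∂μ := by
    intro s
    have := measure_univ_rpow_le_lintegral_rpow (μ := μ.restrict (Ioi s)) hWm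
      (fun c => (Measure.restrict_apply_le _ _).trans
        (measure_le_of_forall_measure_Ioi_le fun _ h => h)) ha
    rwa [Measure.restrict_apply_univ] at this
  have hS : ∀ t, ∫⁻ s in Iio t, ν (Iio s) ^ (γ - 1) ∂ν ≤ K * ν (Iio t) ^ γ := fun t =>
    hKle _ _ _ hSm (fun c => (Measure.restrict_apply_le _ _).trans
      (measure_le_of_forall_measure_Iio_le fun _ h => h)) (measure_ne_top _ _)
      ((ae_restrict_iff' measurableSet_Iio).2 <| ae_of_all _ fun s hs =>
        measure_mono (Iio_subset_Iio (le_of_lt hs)))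
  set G : ℝ → ℝ → ℝ≥0∞ := fun s t =>
    {z : ℝ × ℝ | z.1 < z.2}.indicator (fun z => μ (Ioi z.2) ^ a * ν (Iio z.1) ^ (γ - 1)) (s, t)
    with hG
  have hGm : Measurable (Function.uncurry G) :=
    (((hWm.comp measurable_snd).pow_const _).mul
      ((hSm.comp measurable_fst).pow_const _)).indicator
        (measurableSet_lt measurable_fst measurable_snd)
  have hG1 : ∀ s, ∫⁻ t, G s t ∂μ = (∫⁻ t in Ioi s, μ (Ioi t) ^ a ∂μ) * ν (Iio s) ^ (γ - 1) := by
    intro s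
    rw [← lintegral_mul_const _ (hWm.pow_const _), ← lintegral_indicator measurableSet_Ioi]
    rfl
  have hG2 : ∀ t, ∫⁻ s, G s t ∂ν = μ (Ioi t) ^ a * ∫⁻ s in Iio t, ν (Iio s) ^ (γ - 1) ∂ν := by
    intro t
    rw [← lintegral_const_mul _ (hSm.pow_const _), ← lintegral_indicator measurableSet_Iio]
    rfl
  calc ∫⁻ s, μ (Ioi s) ^ (a + 1) * ν (Iio s) ^ (γ - 1) ∂ν
      ≤ ∫⁻ s, 2 ^ (a + 1) * ∫⁻ t, G s t ∂μ ∂ν := by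
        refine lintegral_mono fun s => ?_
        simp only [hG1]
        rw [← mul_assoc]
        exact mul_le_mul_left (hW s) _
    _ = 2 ^ (a + 1) * ∫⁻ s, ∫⁻ t, G s t ∂μ ∂ν :=
        lintegral_const_mul _ hGm.lintegral_prod_right
    _ = 2 ^ (a + 1) * ∫⁻ t, ∫⁻ s, G s t ∂ν ∂μ := by
        rw [lintegral_lintegral_swap hGm.aemeasurable]
    _ ≤ 2 ^ (a + 1) * ∫⁻ t, K * (ν (Iio t) ^ γ * μ (Ioi t) ^ a) ∂μ := by
        gcongr with t
        rw [hG2]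
        calc _ ≤ _ := mul_le_mul_right (hS t) _
          _ = _ := by ring
    _ = _ := by
        have : Measurable fun t => ν (Iio t) ^ γ * μ (Ioi t) ^ a :=
          (hSm.pow_const _).mul (hWm.pow_const _)
        rw [lintegral_const_mul _ this, mul_assoc]

lemma exists_lintegral_le_of_hardy {p q r p' : ℝ} (hpp : p.HolderConjugate p') (hq : 0 < q)
    (hr : 0 < r) (hqr : 1 / r = 1 / q - 1 / p) :
    ∃ K : ℝ≥0∞, K ≠ ∞ ∧ ∀ (m : Measure ℝ) [NullSingletonClass m] (v w σ₀ w₀ : ℝ → ℝ≥0∞)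
      (C : ℝ≥0∞), Measurable σ₀ → Measurable w₀ →
      ∫⁻ s, σ₀ s ∂m ≠ ∞ → ∫⁻ s, w₀ s ∂m ≠ ∞ →
      (∀ s, σ₀ s ^ (p - 1) * v s ≤ 1) → (∀ s, w₀ s ≤ w s) →
      (∀ f : ℝ → ℝ≥0∞, Measurable f → (∫⁻ t, (∫⁻ s in Iio t, f s ∂m) ^ q * w t ∂m) ^ (1 / q) ≤
        C * (∫⁻ s, f s ^ p * v s ∂m) ^ (1 / p)) →
      ∫⁻ t, (∫⁻ s in Iio t, σ₀ s ∂m) ^ (r / p') * (∫⁻ s in Ioi t, w₀ s ∂m) ^ (r / p) * w₀ t ∂m ≤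
        (K * C) ^ r := by
  have hp := hpp.pos
  have hp1 := hpp.lt
  have hp' := hpp.symm.pos
  obtain ⟨K, hK, hKle⟩ := exists_lintegral_rpow_mul_rpow_le (a := r / p) (γ := r / p')
    (by positivity) (by positivity)
  set β : ℝ := r / (p' * q) with hβ
  have hβ0 : 0 < β := by positivity
  refine ⟨2 ^ β * K ^ (1 / p), ENNReal.mul_ne_top (by simp)
    (ENNReal.rpow_ne_top_of_nonneg (by positivity) hK), ?_⟩
  intro m _ v w σ₀ w₀ C hσ₀ hw₀ hσfin hwfin hσv hww hH
  set μ := m.withDensity w₀ with hμ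
  set ν := m.withDensity σ₀ with hν
  have : IsFiniteMeasure μ := isFiniteMeasure_withDensity hwfin
  have : IsFiniteMeasure ν := isFiniteMeasure_withDensity hσfin
  have hWm := measurable_measure_Ioi μ
  have hSm := measurable_measure_Iio ν
  have hS : ∀ t, ∫⁻ s in Iio t, σ₀ s ∂m = ν (Iio t) := fun t =>
    (withDensity_apply _ measurableSet_Iio).symm
  have hW : ∀ t, ∫⁻ s in Ioi t, w₀ s ∂m = μ (Ioi t) := fun t =>
    (withDensity_apply _ measurableSet_Ioi).symm
  simp only [hS, hW]
  have hSWm : Measurable fun t => ν (Iio t) ^ (r / p') * μ (Ioi t) ^ (r / p) :=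
    (hSm.pow_const _).mul (hWm.pow_const _)
  have hX : ∫⁻ t, ν (Iio t) ^ (r / p') * μ (Ioi t) ^ (r / p) * w₀ t ∂m =
      ∫⁻ t, ν (Iio t) ^ (r / p') * μ (Ioi t) ^ (r / p) ∂μ := by
    rw [hμ, lintegral_withDensity_eq_lintegral_mul _ hw₀ hSWm]
    exact lintegral_congr fun t => mul_comm _ _
  rw [hX]
  set X := ∫⁻ t, ν (Iio t) ^ (r / p') * μ (Ioi t) ^ (r / p) ∂μ with hXdef
  have hXfin : X ≠ ∞ := by
    have : X ≤ ∫⁻ _, ν univ ^ (r / p') * μ univ ^ (r / p) ∂μ := by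
      refine lintegral_mono fun t => ?_
      dsimp only
      gcongr <;> exact subset_univ _
    refine ne_top_of_le_ne_top ?_ this
    rw [lintegral_const]
    refine ENNReal.mul_ne_top (ENNReal.mul_ne_top ?_ ?_) (measure_ne_top _ _) <;>
    exact ENNReal.rpow_ne_top_of_nonneg (by positivity) (measure_ne_top _ _)
  rcases eq_or_ne X 0 with hX0 | hX0
  · rw [hX0]; exact zero_le
  set f : ℝ → ℝ≥0∞ := fun s => μ (Ioi s) ^ (r / (p * q)) * (σ₀ s * ν (Iio s) ^ (β - 1)) with hf
  have hfm : Measurable f := (hWm.pow_const _).mul (hσ₀.mul (hSm.pow_const _))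
  have hF : ∀ t, ν (Iio t) ^ (r / p') * μ (Ioi t) ^ (r / p) ≤
      2 ^ (β * q) * (∫⁻ s in Iio t, f s ∂m) ^ q := by
    intro t
    have h1 : ν (Iio t) ^ β ≤ 2 ^ β * ∫⁻ s in Iio t, ν (Iio s) ^ (β - 1) ∂ν := by
      have := measure_univ_rpow_le_lintegral_rpow_sub_one (μ := ν.restrict (Iio t)) hSm
        (fun c => (Measure.restrict_apply_le _ _).trans
          (measure_le_of_forall_measure_Iio_le fun _ h => h))
        (by
          rw [Measure.restrict_apply_univ]
          exact (ae_restrict_iff' measurableSet_Iio).2 <| ae_of_all _ fun s hs =>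
            measure_mono (Iio_subset_Iio (le_of_lt hs))) hβ0
      rwa [Measure.restrict_apply_univ] at this
    have h2 : μ (Ioi t) ^ (r / (p * q)) * ∫⁻ s in Iio t, ν (Iio s) ^ (β - 1) ∂ν ≤
        ∫⁻ s in Iio t, f s ∂m := by
      rw [hν, setLIntegral_withDensity_eq_setLIntegral_mul _ hσ₀ (hSm.pow_const _)
        measurableSet_Iio, ← lintegral_const_mul _ (hσ₀.mul (hSm.pow_const _))]
      refine setLIntegral_mono' measurableSet_Iio fun s hs => ?_
      simp only [hf, Pi.mul_apply]
      gcongr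
      exact le_of_lt hs
    have h3 : ν (Iio t) ^ β * μ (Ioi t) ^ (r / (p * q)) ≤ 2 ^ β * ∫⁻ s in Iio t, f s ∂m := by
      calc _ ≤ (2 ^ β * ∫⁻ s in Iio t, ν (Iio s) ^ (β - 1) ∂ν) * μ (Ioi t) ^ (r / (p * q)) := by
            gcongr
        _ = 2 ^ β * (μ (Ioi t) ^ (r / (p * q)) * ∫⁻ s in Iio t, ν (Iio s) ^ (β - 1) ∂ν) := by
            ring
        _ ≤ _ := by gcongr
    have h4 := ENNReal.rpow_le_rpow h3 hq.le
    have c1 : β * q = r / p' := by rw [hβ]; field_simp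
    have c2 : r / (p * q) * q = r / p := by field_simp
    rw [ENNReal.mul_rpow_of_nonneg _ _ hq.le, ENNReal.mul_rpow_of_nonneg _ _ hq.le,
      ← ENNReal.rpow_mul, ← ENNReal.rpow_mul, ← ENNReal.rpow_mul, c2] at h4
    rw [c1] at h4 ⊢
    exact h4
  have hFm : Measurable fun t => (∫⁻ s in Iio t, f s ∂m) ^ q :=
    (measurable_setLIntegral_Iio m f).pow_const q
  have hXF : X ≤ 2 ^ (β * q) * ∫⁻ t, (∫⁻ s in Iio t, f s ∂m) ^ q * w t ∂m := by
    calc X ≤ ∫⁻ t, 2 ^ (β * q) * (∫⁻ s in Iio t, f s ∂m) ^ q ∂μ := lintegral_mono hF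
      _ = 2 ^ (β * q) * ∫⁻ t, (∫⁻ s in Iio t, f s ∂m) ^ q ∂μ := lintegral_const_mul _ hFm
      _ ≤ _ := by
        refine mul_le_mul_right ?_ _
        rw [hμ, lintegral_withDensity_eq_lintegral_mul _ hw₀ hFm]
        refine lintegral_mono fun t => ?_
        rw [Pi.mul_apply, mul_comm]
        exact mul_le_mul_right (hww t) _
  have hfp : ∫⁻ s, f s ^ p * v s ∂m ≤ K * X := by
    refine le_trans ?_ (hKle μ ν)
    have hm : Measurable fun s => μ (Ioi s) ^ (r / p + 1) * ν (Iio s) ^ (r / p' - 1) :=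
      (hWm.pow_const _).mul (hSm.pow_const _)
    conv_rhs => rw [hν]
    rw [lintegral_withDensity_eq_lintegral_mul _ hσ₀ hm]
    refine lintegral_mono fun s => ?_
    have hrq : r / q = r / p + 1 := by
      have : r / q - r / p = 1 := by
        rw [div_eq_mul_one_div r q, div_eq_mul_one_div r p, ← mul_sub, ← hqr,
          mul_one_div_cancel hr.ne']
      linarith
    have c1 : r / (p * q) * p = r / p + 1 := by rw [← hrq]; field_simp
    have c2 : (β - 1) * p = r / p' - 1 := by
      have h1 : β * p = (r / q) * (p / p') := by rw [hβ]; field_simp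
      have h2 : p / p' = p - 1 := by
        have := hpp.sub_one_mul_conj
        rw [div_eq_iff hp'.ne']; linarith
      have h3 : r / p * (p / p') = r / p' := by field_simp
      rw [sub_mul, h1, hrq, add_mul, h3, h2]; ring
    simp only [hf, Pi.mul_apply]
    rw [ENNReal.mul_rpow_of_nonneg _ _ hp.le, ENNReal.mul_rpow_of_nonneg _ _ hp.le,
      ← ENNReal.rpow_mul, ← ENNReal.rpow_mul, c1, c2]
    have h4 : σ₀ s ^ p = σ₀ s ^ (p - 1) * σ₀ s := by
      conv_lhs => rw [← sub_add_cancel p 1,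
        ENNReal.rpow_add_of_nonneg _ _ (by linarith) zero_le_one, ENNReal.rpow_one]
    rw [h4]
    calc _ = (σ₀ s ^ (p - 1) * v s) *
          (σ₀ s * (μ (Ioi s) ^ (r / p + 1) * ν (Iio s) ^ (r / p' - 1))) := by ring
      _ ≤ 1 * _ := mul_le_mul_left (hσv s) _
      _ = _ := one_mul _
  have h1 : X ^ (1 / q) ≤ 2 ^ β * K ^ (1 / p) * C * X ^ (1 / p) := by
    have hq1 : 0 ≤ 1 / q := by positivity
    have hp1' : 0 ≤ 1 / p := by positivity
    calc X ^ (1 / q)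
        ≤ (2 ^ (β * q) * ∫⁻ t, (∫⁻ s in Iio t, f s ∂m) ^ q * w t ∂m) ^ (1 / q) := by gcongr
      _ = 2 ^ β * (∫⁻ t, (∫⁻ s in Iio t, f s ∂m) ^ q * w t ∂m) ^ (1 / q) := by
          rw [ENNReal.mul_rpow_of_nonneg _ _ hq1, ← ENNReal.rpow_mul, mul_assoc,
            mul_one_div_cancel hq.ne', mul_one]
      _ ≤ 2 ^ β * (C * (∫⁻ s, f s ^ p * v s ∂m) ^ (1 / p)) := by gcongr; exact hH f hfm
      _ ≤ 2 ^ β * (C * (K * X) ^ (1 / p)) := by gcongr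
      _ = _ := by rw [ENNReal.mul_rpow_of_nonneg _ _ hp1']; ring
  have h2 : X ^ (1 / r) ≤ 2 ^ β * K ^ (1 / p) * C := by
    have hXp0 : X ^ (1 / p) ≠ 0 := by simp [ENNReal.rpow_eq_zero_iff, hX0, hXfin]
    have hXpt : X ^ (1 / p) ≠ ∞ := ENNReal.rpow_ne_top_of_nonneg (by positivity) hXfin
    rw [← ENNReal.mul_le_mul_iff_left hXp0 hXpt, ← ENNReal.rpow_add _ _ hX0 hXfin, hqr,
      sub_add_cancel]
    exact h1
  calc X = (X ^ (1 / r)) ^ r := by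
        rw [← ENNReal.rpow_mul, one_div_mul_cancel hr.ne', ENNReal.rpow_one]
    _ ≤ _ := by gcongr

end Necessity

section Approximation

lemma iSup_mul_iSup_eq_iSup_mul {a b : ℕ → ℝ≥0∞} (ha : Monotone a) (hb : Monotone b) :
    (⨆ n, a n) * ⨆ n, b n = ⨆ n, a n * b n := by
  refine le_antisymm ?_ (iSup_le fun n => mul_le_mul' (le_iSup a n) (le_iSup b n))
  rw [ENNReal.iSup_mul]
  refine iSup_le fun i => ?_
  rw [ENNReal.mul_iSup]
  refine iSup_le fun j => ?_
  exact (mul_le_mul' (ha (le_max_left i j)) (hb (le_max_right i j))).trans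
    (le_iSup (fun n => a n * b n) (max i j))

lemma iSup_rpow_eq {a : ℕ → ℝ≥0∞} {x : ℝ} (hx : 0 < x) : (⨆ n, a n) ^ x = ⨆ n, a n ^ x :=
  (ENNReal.orderIsoRpow x hx).map_iSup a

lemma exists_seq_lintegral_ne_top {α : Type*} [MeasurableSpace α] (μ : Measure α) [SigmaFinite μ]
    {f : α → ℝ≥0∞} (hf : Measurable f) :
    ∃ φ : ℕ → α → ℝ≥0∞, (∀ n, Measurable (φ n)) ∧ Monotone φ ∧ (∀ x, ⨆ n, φ n x = f x) ∧
      ∀ n, ∫⁻ x, φ n x ∂μ ≠ ∞ := by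
  obtain ⟨g, hg0, hgm, hg⟩ := exists_pos_lintegral_lt_of_sigmaFinite μ (ε := 1) (by simp)
  refine ⟨fun n x => min (f x) (n * g x), fun n => ?_, fun i j hij x => ?_, fun x => ?_,
    fun n => ?_⟩
  · exact hf.min (measurable_const.mul hgm.coe_nnreal_ennreal)
  · dsimp only; gcongr
  · rw [← inf_iSup_eq, ← ENNReal.iSup_mul, ENNReal.iSup_natCast,
      ENNReal.top_mul (by simpa using (hg0 x).ne')]
    simp
  · refine ne_top_of_le_ne_top ?_ (lintegral_mono fun x => min_le_right _ _)
    rw [lintegral_const_mul _ hgm.coe_nnreal_ennreal]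
    exact ENNReal.mul_ne_top (by simp) (ne_top_of_lt hg)

lemma rpow_mul_le_one_of_le_rpow {p p' : ℝ} (hpp : p.HolderConjugate p') {x y : ℝ≥0∞}
    (h : y ≤ x ^ (1 - p')) : y ^ (p - 1) * x ≤ 1 := by
  have h1 : y ^ (p - 1) ≤ x⁻¹ := by
    have := ENNReal.rpow_le_rpow h hpp.sub_one_pos.le
    rwa [← ENNReal.rpow_mul, show (1 - p') * (p - 1) = -1 by
      have := hpp.sub_one_mul_conj
      linarith, ENNReal.rpow_neg_one] at this
  exact (mul_le_mul_left h1 x).trans (ENNReal.inv_mul_le_one x)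

end Approximation

lemma exists_lintegral_weights_le_of_hardy {p q r p' : ℝ} (hpp : p.HolderConjugate p')
    (hq : 0 < q) (hr : 0 < r) (hqr : 1 / r = 1 / q - 1 / p) :
    ∃ K : ℝ≥0∞, K ≠ ∞ ∧ ∀ (m : Measure ℝ) [SigmaFinite m] [NullSingletonClass m]
      (v w : ℝ → ℝ≥0∞) (C : ℝ≥0∞), Measurable v → Measurable w →
      (∀ f : ℝ → ℝ≥0∞, Measurable f → (∫⁻ t, (∫⁻ s in Iio t, f s ∂m) ^ q * w t ∂m) ^ (1 / q) ≤
        C * (∫⁻ s, f s ^ p * v s ∂m) ^ (1 / p)) →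
      ∫⁻ t, (∫⁻ s in Iio t, v s ^ (1 - p') ∂m) ^ (r / p') *
        (∫⁻ s in Ioi t, w s ∂m) ^ (r / p) * w t ∂m ≤ (K * C) ^ r := by
  obtain ⟨K, hK, hKle⟩ := exists_lintegral_le_of_hardy hpp hq hr hqr
  refine ⟨K, hK, fun m _ _ v w C hv hw hH => ?_⟩
  have hγ : 0 < r / p' := div_pos hr hpp.symm.pos
  have hα : 0 < r / p := div_pos hr hpp.pos
  obtain ⟨φ, hφm, hφ, hφs, hφi⟩ := exists_seq_lintegral_ne_top m (hv.pow_const (1 - p'))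
  obtain ⟨ψ, hψm, hψ, hψs, hψi⟩ := exists_seq_lintegral_ne_top m hw
  set S : ℕ → ℝ → ℝ≥0∞ := fun n t => ∫⁻ s in Iio t, φ n s ∂m with hS
  set W : ℕ → ℝ → ℝ≥0∞ := fun n t => ∫⁻ s in Ioi t, ψ n s ∂m with hW
  have hSmono : ∀ t, Monotone fun n => S n t ^ (r / p') := fun t i j hij =>
    ENNReal.rpow_le_rpow (lintegral_mono (hφ hij)) hγ.le
  have hWmono : ∀ t, Monotone fun n => W n t ^ (r / p) := fun t i j hij =>
    ENNReal.rpow_le_rpow (lintegral_mono (hψ hij)) hα.le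
  have hSWmono : ∀ t, Monotone fun n => S n t ^ (r / p') * W n t ^ (r / p) := fun t i j hij =>
    mul_le_mul' (hSmono t hij) (hWmono t hij)
  have hψt : ∀ t, Monotone fun n => ψ n t := fun t i j hij => hψ hij t
  have hsup : ∀ t, (∫⁻ s in Iio t, v s ^ (1 - p') ∂m) ^ (r / p') *
      (∫⁻ s in Ioi t, w s ∂m) ^ (r / p) * w t =
      ⨆ n, S n t ^ (r / p') * W n t ^ (r / p) * ψ n t := by
    intro t
    have h1 : ∫⁻ s in Iio t, v s ^ (1 - p') ∂m = ⨆ n, S n t := by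
      rw [hS, ← lintegral_iSup hφm hφ]
      exact lintegral_congr fun s => (hφs s).symm
    have h2 : ∫⁻ s in Ioi t, w s ∂m = ⨆ n, W n t := by
      rw [hW, ← lintegral_iSup hψm hψ]
      exact lintegral_congr fun s => (hψs s).symm
    rw [h1, h2, ← hψs t, iSup_rpow_eq hγ, iSup_rpow_eq hα,
      iSup_mul_iSup_eq_iSup_mul (hSmono t) (hWmono t),
      iSup_mul_iSup_eq_iSup_mul (hSWmono t) (hψt t)]
  rw [lintegral_congr hsup, lintegral_iSup]
  · refine iSup_le fun n => hKle m v w (φ n) (ψ n) C (hφm n) (hψm n) (hφi n) (hψi n)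
      (fun s => ?_) (fun s => ?_) hH
    · exact rpow_mul_le_one_of_le_rpow hpp ((le_iSup (fun n => φ n s) n).trans_eq (hφs s))
    · exact (le_iSup (fun n => ψ n s) n).trans_eq (hψs s)
  · exact fun n => (((measurable_setLIntegral_Iio m _).pow_const _).mul
      ((measurable_setLIntegral_Ioi m _).pow_const _)).mul (hψm n)
  · exact fun i j hij t => mul_le_mul' (hSWmono t hij) (hψt t hij)

lemma exists_hardy_of_lintegral_weights_ne_top {p q r p' : ℝ} (hpp : p.HolderConjugate p')
    (hq : 0 < q) (hr : 0 < r) (hqr : 1 / r = 1 / q - 1 / p) (m : Measure ℝ)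
    [NullSingletonClass m] {v w : ℝ → ℝ≥0∞} (hv : Measurable v) (hw : Measurable w)
    (hB : ∫⁻ t, (∫⁻ s in Iio t, v s ^ (1 - p') ∂m) ^ (r / p') *
      (∫⁻ s in Ioi t, w s ∂m) ^ (r / p) * w t ∂m ≠ ∞) :
    ∃ C : ℝ, 0 < C ∧ ∀ f : ℝ → ℝ≥0∞, Measurable f →
      (∫⁻ t, (∫⁻ s in Iio t, f s ∂m) ^ q * w t ∂m) ^ (1 / q) ≤
        ENNReal.ofReal C * (∫⁻ s, f s ^ p * v s ∂m) ^ (1 / p) := by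
  have hp := hpp.pos
  set B := ∫⁻ t, (∫⁻ s in Iio t, v s ^ (1 - p') ∂m) ^ (r / p') *
      (∫⁻ s in Ioi t, w s ∂m) ^ (r / p) * w t ∂m with hBdef
  have hBμ : ∫⁻ t, (∫⁻ s in Iio t, v s ^ (1 - p') ∂m) ^ (r / p') *
      (∫⁻ s in Ioi t, w s ∂m) ^ (r / p) ∂(m.withDensity w) = B := by
    have hm : Measurable fun t => (∫⁻ s in Iio t, v s ^ (1 - p') ∂m) ^ (r / p') *
      (∫⁻ s in Ioi t, w s ∂m) ^ (r / p) := ((measurable_setLIntegral_Iio m _).pow_const _).mul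
      ((measurable_setLIntegral_Ioi m _).pow_const _)
    rw [lintegral_withDensity_eq_lintegral_mul _ hw hm]
    exact lintegral_congr fun t => mul_comm _ _
  set K : ℝ≥0∞ := (2 * 4 ^ q * (2 ^ (q / p) * B ^ (q / r))) ^ (1 / q) with hKdef
  have hK : K ≠ ∞ := by
    refine ENNReal.rpow_ne_top_of_nonneg (by positivity) ?_
    refine ENNReal.mul_ne_top (ENNReal.mul_ne_top (by simp) ?_) (ENNReal.mul_ne_top ?_ ?_)
    · exact ENNReal.rpow_ne_top_of_nonneg hq.le (by simp)
    · exact ENNReal.rpow_ne_top_of_nonneg (by positivity) (by simp)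
    · exact ENNReal.rpow_ne_top_of_nonneg (by positivity) hB
  refine ⟨K.toReal + 1, by positivity, fun f hf => ?_⟩
  have hKC : K ≤ ENNReal.ofReal (K.toReal + 1) := by
    rw [ENNReal.le_ofReal_iff_toReal_le hK (by positivity)]; linarith
  by_cases hA : ∫⁻ s, f s ^ p * v s ∂m = ∞
  · rw [hA, ENNReal.top_rpow_of_pos (by positivity), ENNReal.mul_top]
    · exact le_top
    · exact (ENNReal.ofReal_pos.2 (by positivity)).ne'
  have h1 := lintegral_rpow_le_of_lintegral_ne_top m hpp hq hr hqr hf hv hA (hBμ ▸ hB)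
  have hm : Measurable fun t => (∫⁻ s in Iio t, f s ∂m) ^ q :=
    (measurable_setLIntegral_Iio m f).pow_const q
  rw [hBμ, lintegral_withDensity_eq_lintegral_mul _ hw hm] at h1
  have hq1 : 0 ≤ 1 / q := by positivity
  have hqp : 0 ≤ q / p := by positivity
  calc (∫⁻ t, (∫⁻ s in Iio t, f s ∂m) ^ q * w t ∂m) ^ (1 / q)
      ≤ (2 * 4 ^ q * ((2 * ∫⁻ s, f s ^ p * v s ∂m) ^ (q / p) * B ^ (q / r))) ^ (1 / q) := by
        gcongr
        refine le_trans (le_of_eq ?_) h1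
        exact lintegral_congr fun t => mul_comm _ _
    _ = K * (∫⁻ s, f s ^ p * v s ∂m) ^ (1 / p) := by
        have e : 2 * 4 ^ q * ((2 * ∫⁻ s, f s ^ p * v s ∂m) ^ (q / p) * B ^ (q / r)) =
            (2 * 4 ^ q * (2 ^ (q / p) * B ^ (q / r))) *
              (∫⁻ s, f s ^ p * v s ∂m) ^ (q / p) := by
          rw [ENNReal.mul_rpow_of_nonneg _ _ hqp]; ring
        rw [e, ENNReal.mul_rpow_of_nonneg _ _ hq1, ← ENNReal.rpow_mul _ (q / p),
          show q / p * (1 / q) = 1 / p by field_simp]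
    _ ≤ _ := by gcongr

/-- The two-weight Hardy inequality, non-convex case `1 < p < ∞`, `0 < q < p`,
`r = pq/(p-q)`: the inequality holds with some positive constant `C` for all
nonnegative measurable `f` iff `∫_0^∞ V(t)^r W(t)^{r/p} w(t) dt < ∞`. -/
theorem hardy_nonconvex_case_p_gt_one (p q r p' : ℝ) (hp : 1 < p) (hq : 0 < q)
    (hqp : q < p) (hr : r = p * q / (p - q)) (hp' : p' = p / (p - 1))
    (v w : ℝ → ℝ≥0∞) (hv : Measurable v) (hw : Measurable w) :
    (∃ C : ℝ, 0 < C ∧ ∀ f : ℝ → ℝ≥0∞, Measurable f →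
        (∫⁻ t in Ioi (0 : ℝ), (∫⁻ s in Ioo 0 t, f s) ^ q * w t) ^ (1 / q) ≤
          ENNReal.ofReal C * (∫⁻ s in Ioi (0 : ℝ), f s ^ p * v s) ^ (1 / p)) ↔
    (∫⁻ t in Ioi (0 : ℝ),
        ((∫⁻ s in Ioo 0 t, v s ^ (1 - p')) ^ (1 / p')) ^ r *
          (∫⁻ s in Ioi t, w s) ^ (r / p) * w t) < ⊤ := by
  have hpp : p.HolderConjugate p' := hp' ▸ Real.HolderConjugate.conjExponent hp
  have hp0 : 0 < p := hpp.pos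
  have hpq : 0 < p - q := sub_pos.2 hqp
  have hr0 : 0 < r := by rw [hr]; positivity
  have hqr : 1 / r = 1 / q - 1 / p := by rw [hr]; field_simp
  set m : Measure ℝ := volume.restrict (Ioi 0) with hm
  have hIoo : ∀ (f : ℝ → ℝ≥0∞) (t : ℝ), ∫⁻ s in Ioo 0 t, f s = ∫⁻ s in Iio t, f s ∂m := by
    intro f t
    rw [hm, Measure.restrict_restrict measurableSet_Iio, inter_comm, Ioi_inter_Iio]
  have hcond : (∫⁻ t in Ioi (0 : ℝ),
        ((∫⁻ s in Ioo 0 t, v s ^ (1 - p')) ^ (1 / p')) ^ r *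
          (∫⁻ s in Ioi t, w s) ^ (r / p) * w t) =
      ∫⁻ t, (∫⁻ s in Iio t, v s ^ (1 - p') ∂m) ^ (r / p') *
        (∫⁻ s in Ioi t, w s ∂m) ^ (r / p) * w t ∂m := by
    refine setLIntegral_congr_fun measurableSet_Ioi fun t ht => ?_
    rw [hIoo, ← ENNReal.rpow_mul, one_div_mul_eq_div, hm,
      Measure.restrict_restrict measurableSet_Ioi,
      inter_eq_left.2 (Ioi_subset_Ioi (le_of_lt ht))]
  rw [hcond]
  simp only [hIoo]
  constructor
  · rintro ⟨C, -, hC⟩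
    obtain ⟨K, hK, hKle⟩ := exists_lintegral_weights_le_of_hardy hpp hq hr0 hqr
    refine (hKle m v w (ENNReal.ofReal C) hv hw hC).trans_lt ?_
    exact ENNReal.rpow_lt_top_of_nonneg hr0.le (ENNReal.mul_ne_top hK ENNReal.ofReal_ne_top)
  · intro h
    exact exists_hardy_of_lintegral_weights_ne_top hpp hq hr0 hqr m hv hw h.ne
end

section
/- (Necessity of the supremum condition, p > 1.) Let p ∈ (1,∞), q ∈ (0,∞), and let v, w be weights on (0,∞). If the two-weight Hardy inequality holds with a positive constant C for every nonnegative measurable function f on (0,∞), then sup_{t∈(0,∞)} W(t)^{1/q} V(t) ≤ C. -/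
open MeasureTheory Set ENNReal

/-- A truncation `x` of `a ^ (1 - p')` satisfies `x ^ p * a ≤ x`, also for `a = 0` and `a = ∞`. -/
lemma ENNReal.rpow_mul_le_self_of_le_rpow {p p' : ℝ} (hpp : p.HolderConjugate p') {a x : ℝ≥0∞}
    (hx : x ≤ a ^ (1 - p')) : x ^ p * a ≤ x := by
  have hp := hpp.lt
  have hp' := hpp.symm.lt
  rcases eq_or_ne a 0 with rfl | ha0
  · simp
  rcases eq_or_ne a ∞ with rfl | ha
  · rw [ENNReal.top_rpow_of_neg (by linarith)] at hx
    simp [le_antisymm hx bot_le, hpp.pos]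
  have hexp : (1 - p') * (p - 1) = -1 := by
    have := hpp.mul_eq_add
    linarith
  have hx' : x ^ (p - 1) * a ≤ 1 := calc
    x ^ (p - 1) * a ≤ (a ^ (1 - p')) ^ (p - 1) * a := by gcongr
    _ = 1 := by
      rw [← ENNReal.rpow_mul, hexp, ENNReal.rpow_neg_one, ENNReal.inv_mul_cancel ha0 ha]
  calc x ^ p * a = x * (x ^ (p - 1) * a) := by
        rw [← mul_assoc]
        nth_rewrite 2 [← ENNReal.rpow_one x]
        rw [← ENNReal.rpow_add_of_nonneg _ _ zero_le_one (by linarith)]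
        congr 2
        ring
    _ ≤ x * 1 := by gcongr
    _ = x := mul_one x

/-- Testing the Hardy inequality on functions supported in `(0, t)`. -/
lemma rpow_lintegral_Ioi_mul_lintegral_Ioo_le {p q : ℝ} (hp : 0 < p) (hq : 0 < q)
    {v w : ℝ → ℝ≥0∞} {C : ℝ≥0∞}
    (hhardy : ∀ f : ℝ → ℝ≥0∞, Measurable f →
      (∫⁻ t in Ioi (0 : ℝ), (∫⁻ s in Ioo 0 t, f s) ^ q * w t) ^ (1 / q) ≤
        C * (∫⁻ s in Ioi (0 : ℝ), f s ^ p * v s) ^ (1 / p))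
    {t : ℝ} (ht : 0 < t) {f : ℝ → ℝ≥0∞} (hf : Measurable f)
    (hfin : ∫⁻ s in Ioo 0 t, f s ≠ ∞) :
    (∫⁻ s in Ioi t, w s) ^ (1 / q) * ∫⁻ s in Ioo 0 t, f s ≤
      C * (∫⁻ s in Ioo 0 t, f s ^ p * v s) ^ (1 / p) := by
  set g := (Ioo 0 t).indicator f with hg
  have hgf : ∫⁻ s in Ioo 0 t, g s = ∫⁻ s in Ioo 0 t, f s :=
    setLIntegral_congr_fun measurableSet_Ioo fun s hs => indicator_of_mem hs f
  have hright : ∫⁻ s in Ioi (0 : ℝ), g s ^ p * v s = ∫⁻ s in Ioo 0 t, f s ^ p * v s := by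
    have : (fun s => g s ^ p * v s) = (Ioo 0 t).indicator fun s => f s ^ p * v s := by
      ext s
      by_cases hs : s ∈ Ioo 0 t <;> simp [hg, hs, hp]
    rw [this, setLIntegral_indicator measurableSet_Ioo,
      inter_eq_left.2 Ioo_subset_Ioi_self]
  have hleft : (∫⁻ s in Ioo 0 t, f s) ^ q * ∫⁻ s in Ioi t, w s ≤
      ∫⁻ x in Ioi (0 : ℝ), (∫⁻ s in Ioo 0 x, g s) ^ q * w x := by
    rw [← lintegral_const_mul' _ _ (ENNReal.rpow_ne_top_of_nonneg hq.le hfin)]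
    refine (setLIntegral_mono' measurableSet_Ioi fun x hx => ?_).trans
      (lintegral_mono_set (Ioi_subset_Ioi ht.le))
    rw [← hgf]
    gcongr
    exact (mem_Ioi.1 hx).le
  calc (∫⁻ s in Ioi t, w s) ^ (1 / q) * ∫⁻ s in Ioo 0 t, f s
      = ((∫⁻ s in Ioo 0 t, f s) ^ q * ∫⁻ s in Ioi t, w s) ^ (1 / q) := by
        rw [ENNReal.mul_rpow_of_nonneg _ _ (by positivity), ← ENNReal.rpow_mul,
          mul_one_div_cancel hq.ne', ENNReal.rpow_one, mul_comm]
    _ ≤ (∫⁻ x in Ioi (0 : ℝ), (∫⁻ s in Ioo 0 x, g s) ^ q * w x) ^ (1 / q) := by gcongr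
    _ ≤ C * (∫⁻ s in Ioi (0 : ℝ), g s ^ p * v s) ^ (1 / p) :=
        hhardy g (hf.indicator measurableSet_Ioo)
    _ = C * (∫⁻ s in Ioo 0 t, f s ^ p * v s) ^ (1 / p) := by rw [hright]

lemma ENNReal.iSup_min_natCast (a : ℝ≥0∞) : ⨆ n : ℕ, min a n = a := by
  rw [← inf_iSup_eq, ENNReal.iSup_natCast, inf_top_eq]

lemma lintegral_eq_iSup_lintegral_min_natCast {α : Type*} [MeasurableSpace α] (μ : Measure α)
    {f : α → ℝ≥0∞} (hf : Measurable f) :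
    ∫⁻ x, f x ∂μ = ⨆ n : ℕ, ∫⁻ x, min (f x) n ∂μ := by
  rw [← lintegral_iSup (fun n => hf.min measurable_const)
    fun m n hmn x => min_le_min_left _ (Nat.cast_le.2 hmn)]
  simp_rw [ENNReal.iSup_min_natCast]

/-- Necessity of the supremum condition, `p > 1`: if the two-weight Hardy
inequality holds with positive constant `C`, then
`sup_{t>0} W(t)^{1/q} V(t) ≤ C`. -/
theorem hardy_necessity_sup_p_gt_one (p q p' : ℝ) (hp : 1 < p) (hq : 0 < q)
    (hp' : p' = p / (p - 1))
    (v w : ℝ → ℝ≥0∞) (hv : Measurable v) (hw : Measurable w)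
    (C : ℝ) (hC : 0 < C)
    (hhardy : ∀ f : ℝ → ℝ≥0∞, Measurable f →
      (∫⁻ t in Ioi (0 : ℝ), (∫⁻ s in Ioo 0 t, f s) ^ q * w t) ^ (1 / q) ≤
        ENNReal.ofReal C * (∫⁻ s in Ioi (0 : ℝ), f s ^ p * v s) ^ (1 / p)) :
    (⨆ t ∈ Ioi (0 : ℝ), (∫⁻ s in Ioi t, w s) ^ (1 / q) *
        (∫⁻ s in Ioo 0 t, v s ^ (1 - p')) ^ (1 / p')) ≤ ENNReal.ofReal C := by
  have hpp : p.HolderConjugate p' := (Real.holderConjugate_iff_eq_conjExponent hp).2 hp'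
  have hppos := hpp.pos
  have hp'pos := hpp.symm.pos
  have hm : Measurable fun s => v s ^ (1 - p') := hv.pow_const _
  refine iSup₂_le fun t ht => ?_
  rw [lintegral_eq_iSup_lintegral_min_natCast _ hm,
    ← ENNReal.orderIsoRpow_apply (1 / p') (by positivity), OrderIso.map_iSup, ENNReal.mul_iSup]
  refine iSup_le fun n => ?_
  rw [ENNReal.orderIsoRpow_apply]
  set F := ∫⁻ s in Ioo 0 t, min (v s ^ (1 - p')) n with hF
  have hFtop : F ≠ ∞ := by
    refine ne_top_of_le_ne_top (b := (n : ℝ≥0∞) * volume (Ioo 0 t)) ?_ ?_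
    · exact ENNReal.mul_ne_top (ENNReal.natCast_ne_top n) measure_Ioo_lt_top.ne
    · rw [← setLIntegral_const]
      exact lintegral_mono fun s => min_le_right _ _
  rcases eq_or_ne F 0 with hF0 | hF0
  · simp [hF0, hp'pos]
  have key : (∫⁻ s in Ioi t, w s) ^ (1 / q) * F ≤ ENNReal.ofReal C * F ^ (1 / p) := by
    refine (rpow_lintegral_Ioi_mul_lintegral_Ioo_le hppos hq hhardy ht
      (hm.min measurable_const) hFtop).trans ?_
    gcongr
    refine lintegral_mono fun s => ?_
    exact ENNReal.rpow_mul_le_self_of_le_rpow hpp (min_le_left _ _)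
  have hsplit : F ^ (1 / p') * F ^ (1 / p) = F := by
    rw [← ENNReal.rpow_add _ _ hF0 hFtop, one_div, one_div, add_comm, hpp.inv_add_inv_eq_one,
      ENNReal.rpow_one]
  refine (ENNReal.mul_le_mul_iff_left (by simp [hF0, hFtop])
    (ENNReal.rpow_ne_top_of_nonneg (by positivity) hFtop)).1 (?_ : _ * F ^ (1 / p) ≤ _)
  rwa [mul_assoc, hsplit]
end

section
/- (Necessity of the supremum condition, p = 1.) Let q ∈ (0,∞) and let v, w be weights on (0,∞). If the two-weight Hardy inequality with p = 1 holds with a positive constant C for every nonnegative measurable function f on (0,∞), then sup_{t∈(0,∞)} W(t)^{1/q} V(t) ≤ C, where V(t) = ess sup_{s∈(0,t)} 1/v(s). -/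
open MeasureTheory Set ENNReal

/-- Necessity of the supremum condition, `p = 1`: if the two-weight Hardy
inequality with `p = 1` holds with positive constant `C`, then
`sup_{t>0} W(t)^{1/q} · ess sup_{s∈(0,t)} 1/v(s) ≤ C`. -/
theorem hardy_necessity_sup_p_eq_one (q : ℝ) (hq : 0 < q)
    (v w : ℝ → ℝ≥0∞) (hv : Measurable v) (hw : Measurable w)
    (C : ℝ) (hC : 0 < C)
    (hhardy : ∀ f : ℝ → ℝ≥0∞, Measurable f →
      (∫⁻ t in Ioi (0 : ℝ), (∫⁻ s in Ioo 0 t, f s) ^ q * w t) ^ (1 / q) ≤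
        ENNReal.ofReal C * ∫⁻ s in Ioi (0 : ℝ), f s * v s) :
    (⨆ t ∈ Ioi (0 : ℝ), (∫⁻ s in Ioi t, w s) ^ (1 / q) *
        essSup (fun s => (v s)⁻¹) (volume.restrict (Ioo (0 : ℝ) t))) ≤
      ENNReal.ofReal C := by
  refine iSup₂_le fun t ht => ?_
  rw [mul_comm, ← ENNReal.le_div_iff_mul_le (Or.inr (by simpa using hC)) (Or.inr ofReal_ne_top)]
  refine le_of_forall_lt_imp_le_of_dense fun a ha => ?_
  rw [ENNReal.le_div_iff_mul_le (Or.inr (by simpa using hC)) (Or.inr ofReal_ne_top)]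
  have ha_top : a ≠ ⊤ := ne_top_of_lt ha
  set E : Set ℝ := {s | a < (v s)⁻¹} ∩ Ioo 0 t
  have hsuper : MeasurableSet {s | a < (v s)⁻¹} := measurableSet_lt measurable_const hv.inv
  have hE_meas : MeasurableSet E := hsuper.inter measurableSet_Ioo
  have hE_zero : volume E ≠ 0 := by
    intro h0
    refine ha.not_ge (essSup_le_of_ae_le a ?_)
    rw [← Measure.restrict_apply hsuper] at h0
    filter_upwards [measure_eq_zero_iff_ae_notMem.mp h0] with s hs
    exact not_lt.mp hs
  have hE_top : volume E ≠ ⊤ :=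
    ((measure_mono inter_subset_right).trans_lt measure_Ioo_lt_top).ne
  have hupper : a * ∫⁻ s in Ioi (0 : ℝ), E.indicator 1 s * v s ≤ volume E := by
    rw [← lintegral_const_mul' _ _ ha_top, ← lintegral_indicator_one hE_meas]
    refine (setLIntegral_le_lintegral _ _).trans (lintegral_mono fun s => ?_)
    by_cases hs : s ∈ E
    · have hle : a * v s ≤ 1 :=
        (mul_le_mul_left (le_of_lt hs.1) (v s)).trans (ENNReal.inv_mul_le_one (v s))
      simpa [hs] using hle
    · simp [hs]
  have hlower : volume E * (∫⁻ s in Ioi t, w s) ^ (1 / q) ≤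
      (∫⁻ r in Ioi (0 : ℝ), (∫⁻ s in Ioo 0 r, E.indicator 1 s) ^ q * w r) ^ (1 / q) := by
    have hroot : volume E = (volume E ^ q) ^ (1 / q) := by
      rw [← ENNReal.rpow_mul, mul_one_div_cancel hq.ne', ENNReal.rpow_one]
    rw [hroot, ← ENNReal.mul_rpow_of_nonneg _ _ (by positivity)]
    refine ENNReal.rpow_le_rpow ?_ (by positivity)
    rw [← lintegral_const_mul _ hw]
    refine (setLIntegral_mono' measurableSet_Ioi fun r hr => ?_).trans
      (lintegral_mono_set (Ioi_subset_Ioi (le_of_lt ht)))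
    have hsub : E ⊆ Ioo 0 r := fun s hs => ⟨hs.2.1, hs.2.2.trans hr⟩
    rw [lintegral_indicator_one hE_meas, Measure.restrict_apply hE_meas,
      inter_eq_left.mpr hsub]
  have key := hlower.trans (hhardy _ (measurable_one.indicator hE_meas))
  rw [← ENNReal.mul_le_mul_iff_right hE_zero hE_top]
  calc volume E * (a * (∫⁻ s in Ioi t, w s) ^ (1 / q))
      = a * (volume E * (∫⁻ s in Ioi t, w s) ^ (1 / q)) := mul_left_comm _ _ _
    _ ≤ a * (ENNReal.ofReal C * ∫⁻ s in Ioi (0 : ℝ), E.indicator 1 s * v s) := by gcongr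
    _ = ENNReal.ofReal C * (a * ∫⁻ s in Ioi (0 : ℝ), E.indicator 1 s * v s) :=
        mul_left_comm _ _ _
    _ ≤ ENNReal.ofReal C * volume E := by gcongr
    _ = volume E * ENNReal.ofReal C := mul_comm _ _
end

section
/- (Necessity, non-convex case, p > 1.) Let 1 < p < ∞, 0 < q < p, set r = pq/(p−q), and let v, w be weights on (0,∞). If the two-weight Hardy inequality holds with a positive constant C for every nonnegative measurable function f on (0,∞), then B := ∫_0^∞ V(t)^r W(t)^{r/p} w(t) dt < ∞; moreover B^{1/r} ≤ c·C for a constant c depending only on p and q. -/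
open MeasureTheory Set ENNReal

section NonatomicPower

variable (μ : Measure ℝ) [IsFiniteMeasure μ] [NullSingletonClass μ]

/-- The distribution function of a finite atomless measure pushes the measure forward to
Lebesgue measure on an interval. -/
lemma map_measureReal_Iio :
    μ.map (fun s => μ.real (Iio s)) = volume.restrict (Ioc 0 (μ.real univ)) := by
  have hmono : Monotone fun s => μ.real (Iio s) := fun s t hst =>
    measureReal_mono (Iio_subset_Iio hst)
  have hmeas := hmono.measurable
  refine Measure.ext_of_Iic _ _ fun a => ?_
  rw [Measure.map_apply hmeas measurableSet_Iic, Measure.restrict_apply measurableSet_Iic]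
  have hvol : volume (Iic a ∩ Ioc 0 (μ.real univ)) = ENNReal.ofReal (min (μ.real univ) a) := by
    rw [inter_comm, Ioc_inter_Iic, Real.volume_Ioc, sub_zero]
  rw [hvol]
  set S := (fun s => μ.real (Iio s)) ⁻¹' Iic a with hS
  have hSm : MeasurableSet S := hmeas measurableSet_Iic
  apply le_antisymm
  · rw [ENNReal.ofReal_min, le_min_iff]
    refine ⟨by rw [ofReal_measureReal]; exact measure_mono (subset_univ _), ?_⟩
    refine le_of_forall_lt fun b hb => ?_
    obtain ⟨K, hKS, hK, hbK⟩ := hSm.exists_lt_isCompact hb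
    refine hbK.trans_le ?_
    rcases K.eq_empty_or_nonempty with rfl | hne
    · simp
    · have hmem : sSup K ∈ S := hKS (hK.sSup_mem hne)
      calc μ K ≤ μ (Iic (sSup K)) := measure_mono fun x hx => le_csSup hK.bddAbove hx
        _ = μ (Iio (sSup K)) := measure_congr Iio_ae_eq_Iic.symm
        _ = ENNReal.ofReal (μ.real (Iio (sSup K))) := by rw [ofReal_measureReal]
        _ ≤ ENNReal.ofReal a := ENNReal.ofReal_le_ofReal hmem
  · have hcompl : μ Sᶜ ≤ ENNReal.ofReal (μ.real univ - a) := by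
      refine le_of_forall_lt fun b hb => ?_
      obtain ⟨K, hKS, hK, hbK⟩ := hSm.compl.exists_lt_isCompact hb
      refine hbK.trans_le ?_
      rcases K.eq_empty_or_nonempty with rfl | hne
      · simp
      · have hmem : sInf K ∈ Sᶜ := hKS (hK.sInf_mem hne)
        have hlt : a < μ.real (Iio (sInf K)) := by simpa [hS] using hmem
        have hadd : μ.real (Iio (sInf K)) + μ.real (Iio (sInf K))ᶜ = μ.real univ :=
          measureReal_add_measureReal_compl measurableSet_Iio
        rw [compl_Iio] at hadd
        calc μ K ≤ μ (Ici (sInf K)) := measure_mono fun x hx => csInf_le hK.bddBelow hx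
          _ = ENNReal.ofReal (μ.real (Ici (sInf K))) := by rw [ofReal_measureReal]
          _ ≤ ENNReal.ofReal (μ.real univ - a) := ENNReal.ofReal_le_ofReal (by linarith)
    rcases le_total (μ.real univ) a with h | h
    · have h0 : μ Sᶜ = 0 := by
        rw [ENNReal.ofReal_of_nonpos (by linarith)] at hcompl
        exact le_antisymm hcompl bot_le
      have : μ S = μ univ := by
        have := measure_add_measure_compl (μ := μ) hSm
        rwa [h0, add_zero] at this
      rw [min_eq_left h, ofReal_measureReal, this]
    · rw [min_eq_right h]
      have hreal : μ.real Sᶜ ≤ μ.real univ - a :=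
        ENNReal.toReal_le_of_le_ofReal (by linarith) hcompl
      have hadd : μ.real S + μ.real Sᶜ = μ.real univ := measureReal_add_measureReal_compl hSm
      rw [← ofReal_measureReal (μ := μ) (s := S)]
      exact ENNReal.ofReal_le_ofReal (by linarith)

lemma lintegral_Ioc_rpow_sub_one {m β : ℝ} (hm : 0 ≤ m) (hβ : 0 < β) :
    ∫⁻ x in Ioc 0 m, ENNReal.ofReal x ^ (β - 1) = ENNReal.ofReal (m ^ β / β) := by
  have h1 : ∫⁻ x in Ioc 0 m, ENNReal.ofReal x ^ (β - 1)
      = ∫⁻ x in Ioc 0 m, ENNReal.ofReal (x ^ (β - 1)) :=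
    setLIntegral_congr_fun measurableSet_Ioc fun x hx => ENNReal.ofReal_rpow_of_pos hx.1
  have hint : IntervalIntegrable (fun x : ℝ => x ^ (β - 1)) volume 0 m :=
    intervalIntegral.intervalIntegrable_rpow' (by linarith)
  rw [h1, ← ofReal_integral_eq_lintegral_ofReal, ← intervalIntegral.integral_of_le hm,
    integral_rpow (Or.inl (by linarith)), sub_add_cancel, Real.zero_rpow hβ.ne', sub_zero]
  · exact (intervalIntegrable_iff_integrableOn_Ioc_of_le hm).1 hint
  · exact (ae_restrict_mem measurableSet_Ioc).mono fun x hx => Real.rpow_nonneg hx.1.le _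

lemma lintegral_measure_Iio_rpow {β : ℝ} (hβ : 0 < β) :
    ∫⁻ s, μ (Iio s) ^ (β - 1) ∂μ = ENNReal.ofReal β⁻¹ * μ univ ^ β := by
  have hmono : Monotone fun s => μ.real (Iio s) := fun s t hst =>
    measureReal_mono (Iio_subset_Iio hst)
  have h : ∫⁻ s, μ (Iio s) ^ (β - 1) ∂μ
      = ∫⁻ x, ENNReal.ofReal x ^ (β - 1) ∂(μ.map fun s => μ.real (Iio s)) := by
    rw [lintegral_map (by fun_prop) hmono.measurable]
    exact lintegral_congr fun s => by rw [ofReal_measureReal]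
  rw [h, map_measureReal_Iio, lintegral_Ioc_rpow_sub_one measureReal_nonneg hβ, div_eq_inv_mul,
    ENNReal.ofReal_mul (by positivity),
    ← ENNReal.ofReal_rpow_of_nonneg measureReal_nonneg hβ.le, ofReal_measureReal]

lemma setLIntegral_Iio_measure_Iio_rpow {β : ℝ} (hβ : 0 < β) (t : ℝ) :
    ∫⁻ s in Iio t, μ (Iio s) ^ (β - 1) ∂μ = ENNReal.ofReal β⁻¹ * μ (Iio t) ^ β := by
  have h := lintegral_measure_Iio_rpow (μ.restrict (Iio t)) hβ
  rw [Measure.restrict_apply_univ] at h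
  rw [← h]
  refine setLIntegral_congr_fun measurableSet_Iio fun s hs => ?_
  rw [Measure.restrict_apply measurableSet_Iio,
    inter_eq_left.2 (Iio_subset_Iio (le_of_lt hs))]

lemma setLIntegral_Ioi_measure_Ioi_rpow {β : ℝ} (hβ : 0 < β) (t : ℝ) :
    ∫⁻ s in Ioi t, μ (Ioi s) ^ (β - 1) ∂μ = ENNReal.ofReal β⁻¹ * μ (Ioi t) ^ β := by
  set ν := μ.map (Neg.neg : ℝ → ℝ) with hν
  have hIio : ∀ s, ν (Iio s) = μ (Ioi (-s)) := fun s => by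
    rw [hν, Measure.map_apply measurable_neg measurableSet_Iio]
    congr 1
    ext x
    simp
  have : NullSingletonClass ν := ⟨fun x => by
    rw [hν, Measure.map_apply measurable_neg (measurableSet_singleton x)]
    simp⟩
  have h := setLIntegral_Iio_measure_Iio_rpow ν hβ (-t)
  simp_rw [hIio, neg_neg] at h
  rw [← h, hν, setLIntegral_map measurableSet_Iio _ measurable_neg]
  · simp
  · have : Antitone fun s => μ (Ioi s) := fun s t hst => measure_mono (Ioi_subset_Ioi hst)
    exact (this.measurable.comp measurable_neg).pow_const _

/-- Integration by parts for powers of distribution functions of atomless measures. -/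
lemma lintegral_rpow_mul_rpow_eq (ν : Measure ℝ) [IsFiniteMeasure ν] [NullSingletonClass ν]
    {α γ : ℝ} (hα : 0 < α) (hγ : 0 < γ) :
    ∫⁻ s, μ (Iio s) ^ (α - 1) * ν (Ioi s) ^ γ ∂μ
      = ENNReal.ofReal (γ / α) * ∫⁻ t, μ (Iio t) ^ α * ν (Ioi t) ^ (γ - 1) ∂ν := by
  have hΦ : Measurable fun s => μ (Iio s) :=
    Monotone.measurable fun s t hst => measure_mono (Iio_subset_Iio hst)
  have hW : Measurable fun s => ν (Ioi s) :=
    Antitone.measurable fun s t hst => measure_mono (Ioi_subset_Ioi hst)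
  have hprod : Measurable fun t => μ (Iio t) ^ α * ν (Ioi t) ^ (γ - 1) :=
    (hΦ.pow_const _).mul (hW.pow_const _)
  have hγ' : ∀ s, ν (Ioi s) ^ γ
      = ENNReal.ofReal γ * ∫⁻ t in Ioi s, ν (Ioi t) ^ (γ - 1) ∂ν := fun s => by
    rw [setLIntegral_Ioi_measure_Ioi_rpow ν hγ, ← mul_assoc, ← ENNReal.ofReal_mul hγ.le,
      mul_inv_cancel₀ hγ.ne', ENNReal.ofReal_one, one_mul]
  have hα' : ∀ t, ENNReal.ofReal α⁻¹ * μ (Iio t) ^ α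
      = ∫⁻ s in Iio t, μ (Iio s) ^ (α - 1) ∂μ := fun t =>
    (setLIntegral_Iio_measure_Iio_rpow μ hα t).symm
  let k : ℝ → ℝ → ℝ≥0∞ := fun s t =>
    {x : ℝ × ℝ | x.1 < x.2}.indicator
      (fun x => μ (Iio x.1) ^ (α - 1) * ν (Ioi x.2) ^ (γ - 1)) (s, t)
  have hk : Measurable (Function.uncurry k) :=
    (((hΦ.comp measurable_fst).pow_const _).mul
      ((hW.comp measurable_snd).pow_const _)).indicator
        (measurableSet_lt measurable_fst measurable_snd)
  have hleft : ∀ s, μ (Iio s) ^ (α - 1) * ν (Ioi s) ^ γ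
      = ENNReal.ofReal γ * ∫⁻ t, k s t ∂ν := fun s => by
    have : ∀ t, k s t = (Ioi s).indicator
        (fun t => μ (Iio s) ^ (α - 1) * ν (Ioi t) ^ (γ - 1)) t := fun t => by
      by_cases h : s < t <;> simp [k, indicator, h]
    simp_rw [this]
    rw [lintegral_indicator measurableSet_Ioi, lintegral_const_mul _ (hW.pow_const _), hγ' s]
    ring
  have hright : ∀ t, ENNReal.ofReal α⁻¹ * (μ (Iio t) ^ α * ν (Ioi t) ^ (γ - 1))
      = ∫⁻ s, k s t ∂μ := fun t => by
    have : ∀ s, k s t = (Iio t).indicator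
        (fun s => μ (Iio s) ^ (α - 1) * ν (Ioi t) ^ (γ - 1)) s := fun s => by
      by_cases h : s < t <;> simp [k, indicator, h]
    simp_rw [this]
    rw [lintegral_indicator measurableSet_Iio, lintegral_mul_const _ (hΦ.pow_const _), ← hα' t]
    ring
  simp_rw [hleft]
  rw [lintegral_const_mul _ (Measurable.lintegral_prod_right (f := k) hk),
    lintegral_lintegral_swap hk.aemeasurable]
  simp_rw [← hright]
  rw [lintegral_const_mul _ hprod, ← mul_assoc,
    ← ENNReal.ofReal_mul hγ.le, div_eq_mul_inv]

/-- The weighted Hardy inequality for a pair of finite atomless measures, tested on a product of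
powers of their distribution functions. -/
lemma rpow_lintegral_le_of_hardy (ν : Measure ℝ) [IsFiniteMeasure ν] [NullSingletonClass ν]
    {p q r α β γ : ℝ} (hp : 0 < p) (hq : 0 < q) (hα : 0 < α) (hβ : 0 < β) (hγ : 0 < γ)
    (hγ1 : 0 ≤ γ - 1) (hr : 1 / r = 1 / q - 1 / p) (hr0 : 0 < r) (hβq : β * q = α)
    (hβp : (β - 1) * p = α - 1) (hγq : γ / p * q = γ - 1) {C : ℝ≥0∞}
    (H : ∀ g : ℝ → ℝ≥0∞, Measurable g →
      (∫⁻ t, (∫⁻ s in Iio t, g s ∂μ) ^ q ∂ν) ^ (1 / q) ≤ C * (∫⁻ s, g s ^ p ∂μ) ^ (1 / p)) :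
    (∫⁻ t, μ (Iio t) ^ α * ν (Ioi t) ^ (γ - 1) ∂ν) ^ (1 / r)
      ≤ ENNReal.ofReal (β * (γ / α) ^ (1 / p)) * C := by
  have hΦ : Measurable fun s => μ (Iio s) :=
    Monotone.measurable fun s t hst => measure_mono (Iio_subset_Iio hst)
  have hW : Measurable fun s => ν (Ioi s) :=
    Antitone.measurable fun s t hst => measure_mono (Ioi_subset_Ioi hst)
  have hprod : Measurable fun t => μ (Iio t) ^ α * ν (Ioi t) ^ (γ - 1) :=
    (hΦ.pow_const _).mul (hW.pow_const _)
  set X := ∫⁻ t, μ (Iio t) ^ α * ν (Ioi t) ^ (γ - 1) ∂ν with hX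
  have hXtop : X ≠ ⊤ := by
    refine ne_top_of_le_ne_top ?_ (lintegral_mono (g := fun _ => μ univ ^ α * ν univ ^ (γ - 1))
      fun t => ?_)
    · rw [lintegral_const]
      exact ENNReal.mul_ne_top (ENNReal.mul_ne_top
        (ENNReal.rpow_ne_top_of_nonneg hα.le (measure_ne_top _ _))
        (ENNReal.rpow_ne_top_of_nonneg hγ1 (measure_ne_top _ _))) (measure_ne_top _ _)
    · exact mul_le_mul' (ENNReal.rpow_le_rpow (measure_mono (subset_univ _)) hα.le)
        (ENNReal.rpow_le_rpow (measure_mono (subset_univ _)) hγ1)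
  rcases eq_or_ne X 0 with h0 | h0
  · rw [h0, ENNReal.zero_rpow_of_pos (by positivity)]
    exact bot_le
  let g : ℝ → ℝ≥0∞ := fun s => μ (Iio s) ^ (β - 1) * ν (Ioi s) ^ (γ / p)
  have hg : Measurable g := (hΦ.pow_const _).mul (hW.pow_const _)
  have hright : ∫⁻ s, g s ^ p ∂μ = ENNReal.ofReal (γ / α) * X := by
    rw [hX, ← lintegral_rpow_mul_rpow_eq μ ν hα hγ]
    refine lintegral_congr fun s => ?_
    rw [ENNReal.mul_rpow_of_nonneg _ _ hp.le, ← ENNReal.rpow_mul, ← ENNReal.rpow_mul, hβp,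
      div_mul_cancel₀ _ hp.ne']
  have hinner : ∀ t, ENNReal.ofReal β⁻¹ * μ (Iio t) ^ β * ν (Ioi t) ^ (γ / p)
      ≤ ∫⁻ s in Iio t, g s ∂μ := fun t => by
    rw [← setLIntegral_Iio_measure_Iio_rpow μ hβ, ← lintegral_mul_const _ (hΦ.pow_const _)]
    refine setLIntegral_mono hg fun s hs => ?_
    exact mul_le_mul' le_rfl (ENNReal.rpow_le_rpow
      (measure_mono (Ioi_subset_Ioi (le_of_lt hs))) (by positivity))
  have hleft : ENNReal.ofReal β⁻¹ * X ^ (1 / q)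
      ≤ (∫⁻ t, (∫⁻ s in Iio t, g s ∂μ) ^ q ∂ν) ^ (1 / q) := by
    have h1 : ENNReal.ofReal β⁻¹ * X ^ (1 / q)
        = (ENNReal.ofReal β⁻¹ ^ q * X) ^ (1 / q) := by
      rw [ENNReal.mul_rpow_of_nonneg _ _ (by positivity), ← ENNReal.rpow_mul,
        mul_one_div_cancel hq.ne', ENNReal.rpow_one]
    rw [h1, hX, ← lintegral_const_mul _ hprod]
    refine ENNReal.rpow_le_rpow (lintegral_mono fun t => ?_) (by positivity)
    refine le_trans (le_of_eq ?_) (ENNReal.rpow_le_rpow (hinner t) hq.le)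
    rw [ENNReal.mul_rpow_of_nonneg _ _ hq.le, ENNReal.mul_rpow_of_nonneg _ _ hq.le,
      ← ENNReal.rpow_mul, ← ENNReal.rpow_mul, hβq, hγq, mul_assoc]
  have hmain := hleft.trans (H g hg)
  rw [hright, ENNReal.mul_rpow_of_nonneg _ _ (by positivity)] at hmain
  rw [hr, ENNReal.rpow_sub _ _ h0 hXtop]
  refine ENNReal.div_le_of_le_mul ?_
  calc X ^ (1 / q) = ENNReal.ofReal β * (ENNReal.ofReal β⁻¹ * X ^ (1 / q)) := by
        rw [← mul_assoc, ← ENNReal.ofReal_mul hβ.le, mul_inv_cancel₀ hβ.ne', ENNReal.ofReal_one,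
          one_mul]
    _ ≤ ENNReal.ofReal β * (C * (ENNReal.ofReal (γ / α) ^ (1 / p) * X ^ (1 / p))) := by gcongr
    _ = ENNReal.ofReal (β * (γ / α) ^ (1 / p)) * C * X ^ (1 / p) := by
        rw [ENNReal.ofReal_mul hβ.le,
          ← ENNReal.ofReal_rpow_of_nonneg (by positivity) (by positivity)]
        ring

end NonatomicPower

section Truncation

/-- Truncation of a weight in both height and support. -/
noncomputable def weightTrunc (φ : ℝ → ℝ≥0∞) (n : ℕ) : ℝ → ℝ≥0∞ :=
  (Iio (n : ℝ)).indicator fun s => min (φ s) n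

variable {φ : ℝ → ℝ≥0∞}

lemma measurable_weightTrunc (hφ : Measurable φ) (n : ℕ) : Measurable (weightTrunc φ n) :=
  (hφ.min measurable_const).indicator measurableSet_Iio

lemma weightTrunc_le (n : ℕ) (s : ℝ) : weightTrunc φ n s ≤ φ s :=
  indicator_apply_le' (fun _ => min_le_left _ _) fun _ => bot_le

lemma monotone_weightTrunc : Monotone (weightTrunc φ) := fun m n hmn s => by
  have hmn' : (m : ℝ) ≤ n := by exact_mod_cast hmn
  by_cases hs : s < m
  · rw [weightTrunc, weightTrunc, indicator_of_mem (mem_Iio.2 hs),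
      indicator_of_mem (mem_Iio.2 (hs.trans_le hmn'))]
    exact min_le_min le_rfl (by exact_mod_cast hmn)
  · rw [weightTrunc, indicator_of_notMem (by simpa using hs)]
    exact bot_le

lemma iSup_weightTrunc (s : ℝ) : ⨆ n, weightTrunc φ n s = φ s := by
  refine le_antisymm (iSup_le fun n => weightTrunc_le n s) (le_of_forall_lt fun b hb => ?_)
  obtain ⟨k, hk⟩ := ENNReal.exists_nat_gt hb.ne_top
  obtain ⟨m, hm⟩ := exists_nat_gt s
  refine lt_of_lt_of_le ?_ (le_iSup _ (max k m))
  have hs : s < (max k m : ℕ) := hm.trans_le (by exact_mod_cast le_max_right k m)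
  rw [weightTrunc, indicator_of_mem (mem_Iio.2 hs)]
  exact lt_min hb (hk.trans_le (by exact_mod_cast le_max_left k m))

/-- The measure on `(0, ∞)` whose density is the truncated weight. -/
noncomputable def truncMeasure (φ : ℝ → ℝ≥0∞) (n : ℕ) : Measure ℝ :=
  (volume.restrict (Ioi 0)).withDensity (weightTrunc φ n)

instance (n : ℕ) : NullSingletonClass (truncMeasure φ n) := by
  unfold truncMeasure; infer_instance

instance (n : ℕ) : IsFiniteMeasure (truncMeasure φ n) := by
  refine isFiniteMeasure_withDensity (ne_top_of_le_ne_top ?_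
    (lintegral_mono (g := (Iio (n : ℝ)).indicator fun _ => (n : ℝ≥0∞)) fun s => ?_))
  · rw [lintegral_indicator_const measurableSet_Iio,
      Measure.restrict_apply measurableSet_Iio, inter_comm, Ioi_inter_Iio, Real.volume_Ioo]
    exact ENNReal.mul_ne_top (ENNReal.natCast_ne_top n) ENNReal.ofReal_ne_top
  · exact indicator_le_indicator (min_le_right _ _)

lemma lintegral_truncMeasure (hφ : Measurable φ) (n : ℕ) {g : ℝ → ℝ≥0∞} (hg : Measurable g) :
    ∫⁻ s, g s ∂truncMeasure φ n = ∫⁻ s in Ioi 0, weightTrunc φ n s * g s :=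
  lintegral_withDensity_eq_lintegral_mul _ (measurable_weightTrunc hφ n) hg

lemma setLIntegral_Iio_truncMeasure (hφ : Measurable φ) (n : ℕ) {g : ℝ → ℝ≥0∞}
    (hg : Measurable g) (t : ℝ) :
    ∫⁻ s in Iio t, g s ∂truncMeasure φ n = ∫⁻ s in Ioo 0 t, weightTrunc φ n s * g s := by
  rw [truncMeasure, restrict_withDensity measurableSet_Iio,
    lintegral_withDensity_eq_lintegral_mul _ (measurable_weightTrunc hφ n) hg,
    Measure.restrict_restrict measurableSet_Iio, inter_comm, Ioi_inter_Iio]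
  rfl

lemma truncMeasure_Iio (n : ℕ) (t : ℝ) :
    truncMeasure φ n (Iio t) = ∫⁻ s in Ioo 0 t, weightTrunc φ n s := by
  rw [truncMeasure, withDensity_apply _ measurableSet_Iio,
    Measure.restrict_restrict measurableSet_Iio, inter_comm, Ioi_inter_Iio]

lemma truncMeasure_Ioi (n : ℕ) {t : ℝ} (ht : 0 ≤ t) :
    truncMeasure φ n (Ioi t) = ∫⁻ s in Ioi t, weightTrunc φ n s := by
  rw [truncMeasure, withDensity_apply _ measurableSet_Ioi,
    Measure.restrict_restrict measurableSet_Ioi, Ioi_inter_Ioi, sup_eq_left.2 ht]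

lemma monotone_setLIntegral_weightTrunc (S : Set ℝ) :
    Monotone fun n => ∫⁻ s in S, weightTrunc φ n s := fun _ _ hmn =>
  lintegral_mono (monotone_weightTrunc hmn)

lemma iSup_setLIntegral_weightTrunc (hφ : Measurable φ) (S : Set ℝ) :
    ⨆ n, ∫⁻ s in S, weightTrunc φ n s = ∫⁻ s in S, φ s := by
  rw [← lintegral_iSup (measurable_weightTrunc hφ) monotone_weightTrunc]
  simp_rw [iSup_weightTrunc]

end Truncation

lemma ENNReal.iSup_mul_eq_of_monotone {f g : ℕ → ℝ≥0∞} (hf : Monotone f) (hg : Monotone g) :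
    ⨆ n, f n * g n = (⨆ n, f n) * ⨆ n, g n := by
  refine le_antisymm (iSup_le fun n => mul_le_mul' (le_iSup f n) (le_iSup g n)) ?_
  rw [ENNReal.iSup_mul]
  refine iSup_le fun m => ?_
  rw [ENNReal.mul_iSup]
  refine iSup_le fun n => le_trans ?_ (le_iSup _ (max m n))
  exact mul_le_mul' (hf (le_max_left m n)) (hg (le_max_right m n))

lemma ENNReal.iSup_rpow_of_pos {x : ℝ} (hx : 0 < x) (f : ℕ → ℝ≥0∞) :
    (⨆ n, f n) ^ x = ⨆ n, f n ^ x :=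
  (ENNReal.orderIsoRpow x hx).map_iSup f

/-- Truncating both weights exhausts the integral characterising the Hardy inequality. -/
lemma iSup_lintegral_truncMeasure {φ w : ℝ → ℝ≥0∞} (hφ : Measurable φ) (hw : Measurable w)
    {x y : ℝ} (hx : 0 < x) (hy : 0 < y) :
    ⨆ n, ∫⁻ t, truncMeasure φ n (Iio t) ^ x * truncMeasure w n (Ioi t) ^ y ∂truncMeasure w n
      = ∫⁻ t in Ioi (0 : ℝ), (∫⁻ s in Ioo 0 t, φ s) ^ x * (∫⁻ s in Ioi t, w s) ^ y * w t := by
  have hΦ : ∀ n, Measurable fun t => truncMeasure φ n (Iio t) := fun n =>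
    Monotone.measurable fun s t hst => measure_mono (Iio_subset_Iio hst)
  have hW : ∀ n, Measurable fun t => truncMeasure w n (Ioi t) := fun n =>
    Antitone.measurable fun s t hst => measure_mono (Ioi_subset_Ioi hst)
  have hmeasF : ∀ n, Measurable fun t =>
      truncMeasure φ n (Iio t) ^ x * truncMeasure w n (Ioi t) ^ y := fun n =>
    ((hΦ n).pow_const _).mul ((hW n).pow_const _)
  have hmonoΦ : ∀ t, Monotone fun n => truncMeasure φ n (Iio t) ^ x := fun t => by
    simp_rw [truncMeasure_Iio]
    exact fun m n hmn => ENNReal.rpow_le_rpow (monotone_setLIntegral_weightTrunc _ hmn) hx.le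
  have hmonoW : ∀ t, 0 < t → Monotone fun n => truncMeasure w n (Ioi t) ^ y := fun t ht => by
    simp_rw [truncMeasure_Ioi _ ht.le]
    exact fun m n hmn => ENNReal.rpow_le_rpow (monotone_setLIntegral_weightTrunc _ hmn) hy.le
  have hmonow : ∀ t, Monotone fun n => weightTrunc w n t := fun t m n hmn =>
    monotone_weightTrunc hmn t
  have hmonoΦW : ∀ t, 0 < t → Monotone fun n =>
      truncMeasure φ n (Iio t) ^ x * truncMeasure w n (Ioi t) ^ y := fun t ht m n hmn =>
    mul_le_mul' (hmonoΦ t hmn) (hmonoW t ht hmn)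
  have hmeas : ∀ n, Measurable fun t => weightTrunc w n t *
      (truncMeasure φ n (Iio t) ^ x * truncMeasure w n (Ioi t) ^ y) := fun n =>
    (measurable_weightTrunc hw n).mul (hmeasF n)
  simp_rw [lintegral_truncMeasure hw _ (hmeasF _)]
  rw [← lintegral_iSup' fun n => (hmeas n).aemeasurable]
  · refine setLIntegral_congr_fun measurableSet_Ioi fun t ht => ?_
    have ht' : 0 < t := ht
    rw [ENNReal.iSup_mul_eq_of_monotone (hmonow t) (hmonoΦW t ht'),
      ENNReal.iSup_mul_eq_of_monotone (hmonoΦ t) (hmonoW t ht'), iSup_weightTrunc,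
      ← ENNReal.iSup_rpow_of_pos hx, ← ENNReal.iSup_rpow_of_pos hy]
    simp_rw [truncMeasure_Iio, truncMeasure_Ioi _ ht'.le]
    rw [iSup_setLIntegral_weightTrunc hφ, iSup_setLIntegral_weightTrunc hw, mul_comm]
  · filter_upwards [ae_restrict_mem measurableSet_Ioi] with t ht m n hmn
    exact mul_le_mul' (hmonow t hmn) (hmonoΦW t ht hmn)

/-- The two-weight Hardy inequality passes to the truncated measures. -/
lemma hardy_truncMeasure {p q p' : ℝ} (hp : 1 < p) (hq : 0 < q) (hp' : p' = p / (p - 1))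
    {v w : ℝ → ℝ≥0∞} (hv : Measurable v) (hw : Measurable w) {C : ℝ≥0∞}
    (H : ∀ f : ℝ → ℝ≥0∞, Measurable f →
      (∫⁻ t in Ioi (0 : ℝ), (∫⁻ s in Ioo 0 t, f s) ^ q * w t) ^ (1 / q) ≤
        C * (∫⁻ s in Ioi (0 : ℝ), f s ^ p * v s) ^ (1 / p))
    (n : ℕ) {g : ℝ → ℝ≥0∞} (hg : Measurable g) :
    (∫⁻ t, (∫⁻ s in Iio t, g s ∂truncMeasure (fun s => v s ^ (1 - p')) n) ^ q
        ∂truncMeasure w n) ^ (1 / q) ≤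
      C * (∫⁻ s, g s ^ p ∂truncMeasure (fun s => v s ^ (1 - p')) n) ^ (1 / p) := by
  have hφ : Measurable fun s => v s ^ (1 - p') := hv.pow_const _
  set φ := fun s => v s ^ (1 - p') with hφdef
  have hp1 : 0 < p - 1 := by linarith
  have hexp : (1 - p') * (p - 1) = -1 := by rw [hp']; field_simp; ring
  have hpow : ∀ s, weightTrunc φ n s ^ p * v s ≤ weightTrunc φ n s := fun s => by
    have h1 : weightTrunc φ n s ^ p = weightTrunc φ n s * weightTrunc φ n s ^ (p - 1) := by
      have := ENNReal.rpow_add_of_nonneg (x := weightTrunc φ n s) 1 (p - 1) zero_le_one hp1.le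
      rwa [ENNReal.rpow_one, add_sub_cancel] at this
    have h2 : weightTrunc φ n s ^ (p - 1) * v s ≤ 1 := by
      calc weightTrunc φ n s ^ (p - 1) * v s ≤ φ s ^ (p - 1) * v s :=
            mul_le_mul' (ENNReal.rpow_le_rpow (weightTrunc_le n s) hp1.le) le_rfl
        _ = (v s)⁻¹ * v s := by rw [hφdef, ← ENNReal.rpow_mul, hexp, ENNReal.rpow_neg_one]
        _ ≤ 1 := ENNReal.inv_mul_le_one _
    rw [h1, mul_assoc]
    exact mul_le_of_le_one_right' h2
  have hmono : Monotone fun t => ∫⁻ s in Iio t, g s ∂truncMeasure φ n := fun s t hst =>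
    lintegral_mono_set (Iio_subset_Iio hst)
  rw [lintegral_truncMeasure hw n (hmono.measurable.pow_const q),
    lintegral_truncMeasure hφ n (hg.pow_const p)]
  simp_rw [setLIntegral_Iio_truncMeasure hφ n hg]
  refine le_trans (ENNReal.rpow_le_rpow (lintegral_mono fun t => ?_) (by positivity))
    ((H (fun s => weightTrunc φ n s * g s) ((measurable_weightTrunc hφ n).mul hg)).trans
      (mul_le_mul' le_rfl (ENNReal.rpow_le_rpow (lintegral_mono fun s => ?_) (by positivity))))
  · rw [mul_comm]
    exact mul_le_mul' le_rfl (weightTrunc_le n t)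
  · calc (weightTrunc φ n s * g s) ^ p * v s = weightTrunc φ n s ^ p * v s * g s ^ p := by
          rw [ENNReal.mul_rpow_of_nonneg _ _ (by linarith)]; ring
      _ ≤ weightTrunc φ n s * g s ^ p := mul_le_mul' (hpow s) le_rfl

/-- Necessity, non-convex case `p > 1`, `0 < q < p`, `r = pq/(p-q)`: if the
two-weight Hardy inequality holds with positive constant `C`, then
`B = ∫_0^∞ V^r W^{r/p} w < ∞` and `B^{1/r} ≤ c·C` for a constant `c`
depending only on `p` and `q`. -/
theorem hardy_necessity_nonconvex_p_gt_one (p q r p' : ℝ) (hp : 1 < p)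
    (hq : 0 < q) (hqp : q < p) (hr : r = p * q / (p - q)) (hp' : p' = p / (p - 1)) :
    ∃ c : ℝ, 0 < c ∧
      ∀ (v w : ℝ → ℝ≥0∞), Measurable v → Measurable w →
      ∀ C : ℝ, 0 < C →
      (∀ f : ℝ → ℝ≥0∞, Measurable f →
        (∫⁻ t in Ioi (0 : ℝ), (∫⁻ s in Ioo 0 t, f s) ^ q * w t) ^ (1 / q) ≤
          ENNReal.ofReal C * (∫⁻ s in Ioi (0 : ℝ), f s ^ p * v s) ^ (1 / p)) →
      ∀ B : ℝ≥0∞,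
        B = (∫⁻ t in Ioi (0 : ℝ),
              ((∫⁻ s in Ioo 0 t, v s ^ (1 - p')) ^ (1 / p')) ^ r *
                (∫⁻ s in Ioi t, w s) ^ (r / p) * w t) →
        B < ⊤ ∧ B ^ (1 / r) ≤ ENNReal.ofReal (c * C) := by
  have hpq : 0 < p - q := by linarith
  have hp0 : 0 < p := by linarith
  have hp1 : 0 < p - 1 := by linarith
  have hr0 : 0 < r := by rw [hr]; positivity
  have hp'0 : 0 < p' := by rw [hp']; positivity
  have hα : 0 < r / p' := by positivity
  have hβ : 0 < r / (q * p') := by positivity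
  have hγ : 0 < r / q := by positivity
  have hγ1 : r / q - 1 = r / p := by rw [hr]; field_simp; ring
  have hr1 : 1 / r = 1 / q - 1 / p := by rw [hr]; field_simp
  have hβq : r / (q * p') * q = r / p' := by field_simp
  have hβp : (r / (q * p') - 1) * p = r / p' - 1 := by rw [hp', hr]; field_simp; ring
  have hγq : r / q / p * q = r / q - 1 := by rw [hγ1]; field_simp
  refine ⟨r / (q * p') * (r / q / (r / p')) ^ (1 / p), by positivity,
    fun v w hv hw C hC H B hB => ?_⟩
  have hbound : B ^ (1 / r)
      ≤ ENNReal.ofReal (r / (q * p') * (r / q / (r / p')) ^ (1 / p) * C) := by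
    simp_rw [← ENNReal.rpow_mul, one_div_mul_eq_div] at hB
    rw [hB, ← iSup_lintegral_truncMeasure (hv.pow_const _) hw hα (by positivity),
      ENNReal.iSup_rpow_of_pos (by positivity), ENNReal.ofReal_mul (by positivity)]
    refine iSup_le fun n => ?_
    rw [← hγ1]
    exact rpow_lintegral_le_of_hardy _ _ hp0 hq hα hβ hγ (by rw [hγ1]; positivity) hr1 hr0
      hβq hβp hγq fun g hg => hardy_truncMeasure hp hq hp' hv hw H n hg
  refine ⟨lt_top_iff_ne_top.2 fun htop => ?_, hbound⟩
  rw [htop, ENNReal.top_rpow_of_pos (by positivity)] at hbound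
  exact ENNReal.ofReal_ne_top (top_le_iff.1 hbound)
end
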